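/- arXiv:1009.2568 — 7 statements merged into one kernel-verified Lean document; each statement's English description precedes it below -/
import Mathlib

section
/- Let K be a field of positive characteristic p and let G be a group whose set t(G) of torsion elements satisfies t(G) ≠ {1}. Suppose the unit group U(KG) satisfies: (a) U(KG) contains no subgroup isomorphic to ℤ × ℤ; (b) every torsion subgroup of U(KG) is finite; (c) U(KG) is finitely generated. Then K is a finite field and G is a finite group. Conversely, if K is a finite field and G is a finite group, then U(KG) is finite and conditions (a), (b), (c) hold. -/
/-- Multiplication in the two Peirce corners. -/
theorem aux_peirce {R : Type*} [Ring R] {e : R} (he : e * e = e) (a b c d : R)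
    (hc : c * e = e * c) (hd : d * e = e * d) :
    (a * e + b * (1 - e)) * (c * e + d * (1 - e)) = a * c * e + b * d * (1 - e) := by
  have h1 : e * (c * e) = c * e := by rw [hc, ← mul_assoc, he]
  have h2 : e * (d * (1 - e)) = 0 := by
    rw [← mul_assoc, ← hd, mul_assoc, mul_sub, he, mul_one, sub_self, mul_zero]
  have h3 : (1 - e) * (c * e) = 0 := by rw [sub_mul, one_mul, h1, sub_self]
  have h4 : (1 - e) * (d * (1 - e)) = d * (1 - e) := by rw [sub_mul, one_mul, h2, sub_zero]
  rw [add_mul, mul_add, mul_add, mul_assoc a e, mul_assoc a e, mul_assoc b (1 - e),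
    mul_assoc b (1 - e), h1, h2, h3, h4]
  simp [mul_assoc]

/-- An idempotent and a commuting unit that has infinite order in both corners give `ℤ × ℤ`. -/
theorem aux_zsq {R : Type*} [Ring R] {e : R} (he : e * e = e) (u : Rˣ)
    (hu : (u : R) * e = e * u)
    (h1 : ∀ n : ℤ, ((u ^ n : Rˣ) : R) * e = e → n = 0)
    (h2 : ∀ n : ℤ, ((u ^ n : Rˣ) : R) * (1 - e) = 1 - e → n = 0) :
    ∃ f : Multiplicative (ℤ × ℤ) →* Rˣ, Function.Injective f := by
  have hc : ∀ n : ℤ, ((u ^ n : Rˣ) : R) * e = e * ((u ^ n : Rˣ) : R) := fun n =>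
    (Commute.units_zpow_right (show Commute e (u : R) from hu.symm) n).symm.eq
  let F : ℤ × ℤ → R := fun x => ((u ^ x.1 : Rˣ) : R) * e + ((u ^ x.2 : Rˣ) : R) * (1 - e)
  have hF0 : F 0 = 1 := by simp [F]
  have hF : ∀ x y, F (x + y) = F x * F y := by
    intro x y
    simp only [F]
    rw [aux_peirce he _ _ _ _ (hc _) (hc _)]
    simp [zpow_add]
  let f : Multiplicative (ℤ × ℤ) →* R :=
    { toFun := fun x => F x.toAdd
      map_one' := hF0
      map_mul' := fun x y => hF _ _ }
  refine ⟨f.toHomUnits, ?_⟩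
  rw [injective_iff_map_eq_one]
  intro x hx
  have hx' : F x.toAdd = 1 := congrArg Units.val hx
  have key : ∀ a b : R, a * e + b * (1 - e) = 1 → a * e = e ∧ b * (1 - e) = 1 - e := by
    intro a b h
    have h3 : a * e = e := by
      have := congrArg (· * e) h
      simpa [add_mul, mul_assoc, sub_mul, he] using this
    refine ⟨h3, ?_⟩
    rw [h3] at h
    exact eq_sub_of_add_eq' h
  obtain ⟨k1, k2⟩ := key _ _ hx'
  have := h1 _ k1
  have := h2 _ k2
  apply Multiplicative.toAdd.injective
  apply Prod.ext <;> assumption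

/-- A square-zero additive subgroup in characteristic `p` gives a torsion group of units. -/
theorem aux_sqzero {R : Type*} [Ring R] {p : ℕ} (hp0 : 0 < p) (hp : ∀ x : R, (p : R) * x = 0)
    (hb : ∀ H : Subgroup Rˣ, (∀ x ∈ H, IsOfFinOrder x) → Finite H)
    (S : AddSubgroup R) (hS : ∀ x ∈ S, ∀ y ∈ S, x * y = 0) : (S : Set R).Finite := by
  let H : Subgroup Rˣ :=
    { carrier := {u | (u : R) - 1 ∈ S}
      one_mem' := by simp [S.zero_mem]
      mul_mem' := by
        intro u v hu hv
        have h : ((u * v : Rˣ) : R) - 1 = ((u : R) - 1) * ((v : R) - 1) + (((u : R) - 1) + ((v : R) - 1)) := by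
          push_cast; noncomm_ring
        change ((u * v : Rˣ) : R) - 1 ∈ S
        rw [h, hS _ hu _ hv, zero_add]
        exact S.add_mem hu hv
      inv_mem' := by
        intro u hu
        change ((u⁻¹ : Rˣ) : R) - 1 ∈ S
        have h0 := hS _ hu _ hu
        have h : ((u⁻¹ : Rˣ) : R) = 1 - ((u : R) - 1) := by
          have h1 : (u : R) * (1 - ((u : R) - 1)) = 1 := by
            have : (u : R) * (1 - ((u : R) - 1)) = 1 - ((u : R) - 1) * ((u : R) - 1) := by noncomm_ring
            rw [this, h0, sub_zero]
          rw [Units.inv_eq_of_mul_eq_one_right h1]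
        rw [h]
        have := S.neg_mem hu
        convert this using 1
        abel }
  have hpow : ∀ s ∈ S, ∀ n : ℕ, (1 + s) ^ n = 1 + n * s := by
    intro s hs n
    induction n with
    | zero => simp
    | succ n ih =>
      rw [pow_succ, ih, add_mul, mul_add, mul_add, mul_assoc _ s s, hS s hs s hs]
      push_cast
      simp only [one_mul, mul_one, mul_zero, add_mul]; abel
  have hfin : Finite H := by
    apply hb
    intro u hu
    rw [isOfFinOrder_iff_pow_eq_one]
    refine ⟨p, hp0, ?_⟩
    ext
    have := hpow _ hu p
    rw [hp] at this
    simpa using this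
  have : Set.MapsTo (fun u : Rˣ => (u : R) - 1) (H : Set Rˣ) S := fun u hu => hu
  refine ((Set.toFinite (H : Set Rˣ)).image (fun u : Rˣ => (u : R) - 1)).subset ?_
  intro s hs
  have h0 := hS _ hs _ hs
  refine ⟨⟨1 + s, 1 - s, ?_, ?_⟩, ?_, ?_⟩
  · rw [add_mul, mul_sub, mul_sub, h0]; simp
  · rw [sub_mul, mul_add, mul_add, h0]; simp
  · change (1 + s) - 1 ∈ S
    simpa using hs
  · simp

section
open MonoidAlgebra

/-- Sum of the elements of a finite subgroup. -/
noncomputable def auxN (K : Type*) {G : Type*} [Field K] [Group G] (H : Subgroup G) [Fintype H] :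
    MonoidAlgebra K G := ∑ h : H, single (h : G) (1 : K)

variable {K G : Type*} [Field K] [Group G] (H : Subgroup G) [Fintype H]

open Classical in
theorem auxN_coeff (y : G) : (auxN K H).coeff y = if y ∈ H then 1 else 0 := by
  rw [auxN, coeff_sum, Finsupp.finsetSum_apply]
  simp only [coeff_single, Finsupp.single_apply]
  split_ifs with hy
  · rw [Finset.sum_eq_single (⟨y, hy⟩ : H)]
    · simp
    · intro b _ hb
      rw [if_neg]
      rintro rfl
      exact hb rfl
    · simp
  · apply Finset.sum_eq_zero
    intro b _
    rw [if_neg]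
    rintro rfl
    exact hy b.2

theorem auxN_left {h : G} (hh : h ∈ H) : single h (1 : K) * auxN K H = auxN K H := by
  classical
  ext y
  rw [coeff_single_mul_apply, auxN_coeff, auxN_coeff, one_mul]
  simp [H.mul_mem_cancel_left (H.inv_mem hh)]

theorem auxN_right {h : G} (hh : h ∈ H) : auxN K H * single h (1 : K) = auxN K H := by
  classical
  ext y
  rw [coeff_mul_single_apply, auxN_coeff, auxN_coeff, mul_one]
  simp [H.mul_mem_cancel_right (H.inv_mem hh)]

theorem auxN_sq : auxN K H * auxN K H = (Fintype.card H : K) • auxN K H := by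
  have h0 : auxN K H * auxN K H = (∑ h : H, single (h : G) (1 : K)) * auxN K H := rfl
  rw [h0, Finset.sum_mul, Finset.sum_congr rfl (fun h _ => auxN_left H h.2)]
  simp [Nat.cast_smul_eq_nsmul]

theorem auxN_central [hn : H.Normal] (x : MonoidAlgebra K G) :
    x * auxN K H = auxN K H * x := by
  classical
  induction x using MonoidAlgebra.induction_on with
  | of y =>
    ext z
    rw [of_apply, coeff_single_mul_apply, coeff_mul_single_apply, auxN_coeff, auxN_coeff, mul_one,
      one_mul]
    simp [hn.mem_comm_iff]
  | add x y hx hy => rw [add_mul, mul_add, hx, hy]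
  | smul r x hx => rw [smul_mul_assoc, hx, mul_smul_comm]

theorem aux_p {p : ℕ} [CharP K p] (x : MonoidAlgebra K G) : (p : MonoidAlgebra K G) * x = 0 := by
  rw [← nsmul_eq_mul, ← Nat.cast_smul_eq_nsmul K, CharP.cast_eq_zero, zero_smul]

theorem auxN_ne : auxN K H ≠ 0 := by
  classical
  intro h
  have := auxN_coeff (K := K) H 1
  rw [h] at this
  simp at this

/-- The coset `y H` determines `y` up to finitely many choices. -/
theorem aux_coset_finite (y : G) : {z : G | y⁻¹ * z ∈ H}.Finite := by
  have : {z : G | y⁻¹ * z ∈ H} = (fun z => y⁻¹ * z) ⁻¹' (H : Set G) := rfl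
  rw [this]
  exact (Set.toFinite (H : Set G)).preimage (mul_right_injective _).injOn

/-- If the order of `H` is zero in `K`, then `K` is finite. -/
theorem aux_K_finite {p : ℕ} (hp0 : 0 < p) [CharP K p]
    (hb : ∀ H : Subgroup (MonoidAlgebra K G)ˣ, (∀ x ∈ H, IsOfFinOrder x) → Finite H)
    (hq : (Fintype.card H : K) = 0) : Finite K := by
  have hN : auxN K H * auxN K H = 0 := by rw [auxN_sq, hq, zero_smul]
  have hf := aux_sqzero hp0 (aux_p (K := K) (G := G) (p := p)) hb
    (LinearMap.toSpanSingleton K _ (auxN K H)).range.toAddSubgroup (by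
      rintro _ ⟨a, rfl⟩ _ ⟨b, rfl⟩
      simp [hN])
  have : Set.Finite (Set.univ : Set K) := by
    refine Set.Finite.of_finite_image (f := fun a : K => a • auxN K H) (hf.subset ?_) ?_
    · rintro _ ⟨a, -, rfl⟩
      exact ⟨a, rfl⟩
    · exact (smul_left_injective K (auxN_ne H)).injOn
  exact Set.finite_univ_iff.mp this

theorem aux_G_finite_p {p : ℕ} (hp0 : 0 < p) [CharP K p] [H.Normal]
    (hb : ∀ H : Subgroup (MonoidAlgebra K G)ˣ, (∀ x ∈ H, IsOfFinOrder x) → Finite H)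
    (hq : (Fintype.card H : K) = 0) : Finite G := by
  classical
  have hN : auxN K H * auxN K H = 0 := by rw [auxN_sq, hq, zero_smul]
  have hf := aux_sqzero hp0 (aux_p (K := K) (G := G) (p := p)) hb
    (AddMonoidHom.mulRight (auxN K H)).range (by
      rintro _ ⟨a, rfl⟩ _ ⟨b, rfl⟩
      change a * auxN K H * (b * auxN K H) = 0
      rw [auxN_central H b, mul_assoc, ← mul_assoc (auxN K H), hN]
      simp)
  have := hf.preimage' (f := fun y : G => single y (1 : K) * auxN K H) (by
    rintro _ ⟨a, rfl⟩
    by_cases he : ∃ y0 : G, single y0 (1 : K) * auxN K H = AddMonoidHom.mulRight (auxN K H) a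
    · obtain ⟨y0, hy0⟩ := he
      refine (aux_coset_finite H y0).subset ?_
      intro z hz
      have hz : single z (1 : K) * auxN K H = AddMonoidHom.mulRight (auxN K H) a := hz
      rw [← hy0] at hz
      have := congrArg (fun t => t.coeff z) hz
      simp only [coeff_single_mul_apply, auxN_coeff] at this
      by_contra hc
      have hc : ¬ (y0⁻¹ * z ∈ H) := hc
      simp [hc] at this
    · convert Set.finite_empty
      ext z
      simp only [Set.mem_preimage, Set.mem_singleton_iff, Set.mem_empty_iff_false, iff_false]
      exact fun h => he ⟨z, h⟩)
  refine Set.finite_univ_iff.mp (this.subset ?_)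
  intro y _
  exact ⟨single y 1, rfl⟩

/-- Either `g` normalises or `G` is finite. -/
theorem aux_conj {p : ℕ} (hp0 : 0 < p) [CharP K p]
    (hb : ∀ H : Subgroup (MonoidAlgebra K G)ˣ, (∀ x ∈ H, IsOfFinOrder x) → Finite H)
    {g : G} (hg : g ∈ H) {a : G} (ha : a⁻¹ * g * a ∉ H) : Finite G := by
  classical
  let φ : MonoidAlgebra K G →+ MonoidAlgebra K G :=
    (AddMonoidHom.mulRight (auxN K H)).comp (AddMonoidHom.mulLeft (1 - single g (1 : K)))
  have hφ : ∀ x, φ x = (1 - single g (1 : K)) * x * auxN K H := fun x => rfl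
  have hf := aux_sqzero hp0 (aux_p (K := K) (G := G) (p := p)) hb φ.range (by
      rintro _ ⟨a, rfl⟩ _ ⟨b, rfl⟩
      have h0 : auxN K H * (1 - single g (1 : K)) = 0 := by
        rw [mul_sub, mul_one, auxN_right H hg, sub_self]
      rw [hφ, hφ, mul_assoc (1 - single g (1 : K)) b, mul_assoc _ (auxN K H),
        ← mul_assoc (auxN K H), h0]
      simp)
  have hco : ∀ y z : G, (φ (single y 1)).coeff z =
      (if y⁻¹ * z ∈ H then 1 else 0) - (if (g * y)⁻¹ * z ∈ H then 1 else 0) := by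
    intro y z
    rw [hφ, sub_mul, one_mul, single_mul_single, one_mul, sub_mul, coeff_sub, Finsupp.sub_apply,
      coeff_single_mul_apply, coeff_single_mul_apply, auxN_coeff, auxN_coeff]
    simp
  -- the set of elements not conjugating `g` into `H` is finite
  let B : Set G := {y | y⁻¹ * g * y ∉ H}
  have hB : B.Finite := by
    have key : ∀ y z : G, z ∈ B → φ (single y 1) = φ (single z 1) →
        z ∈ {z : G | y⁻¹ * z ∈ H} ∪ {z : G | (g * y)⁻¹ * z ∈ H} := by
      intro y z hz h
      have h1 := congrArg (fun t => t.coeff z) h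
      simp only [hco] at h1
      have hz' : ¬ ((g * z)⁻¹ * z ∈ H) := by
        intro h
        apply hz
        have := H.inv_mem h
        simpa [mul_assoc] using this
      by_contra hc
      simp only [Set.mem_union, Set.mem_ofPred_eq, not_or] at hc
      rw [if_neg hc.1, if_neg hc.2, if_neg hz', inv_mul_cancel, if_pos H.one_mem] at h1
      simp at h1
    have hBf : ((fun y : B => φ (single (y : G) (1 : K))) ⁻¹' (φ.range : Set _)).Finite := by
      refine hf.preimage' ?_
      rintro b -
      by_cases he : ∃ y0 : B, φ (single (y0 : G) 1) = b
      · obtain ⟨y0, hy0⟩ := he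
        refine Set.Finite.of_finite_image (f := Subtype.val) (((aux_coset_finite H (y0 : G)).union
          (aux_coset_finite H (g * y0))).subset ?_) Subtype.val_injective.injOn
        rintro _ ⟨z, hz, rfl⟩
        exact key _ _ z.2 (hy0.trans (Eq.symm hz))
      · convert Set.finite_empty
        ext z
        simp only [Set.mem_preimage, Set.mem_singleton_iff, Set.mem_empty_iff_false, iff_false]
        exact fun h => he ⟨z, h⟩
    have : Finite B := Set.finite_univ_iff.mp (hBf.subset fun y _ => ⟨_, rfl⟩)
    exact Set.toFinite B
  have hC : {c : G | c⁻¹ * g * c = g}.Finite := by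
    refine Set.Finite.of_finite_image (f := fun c => c * a) (hB.subset ?_)
      (mul_left_injective a).injOn
    rintro _ ⟨c, hc, rfl⟩
    have hc : c⁻¹ * g * c = g := hc
    change (c * a)⁻¹ * g * (c * a) ∉ H
    have : (c * a)⁻¹ * g * (c * a) = a⁻¹ * (c⁻¹ * g * c) * a := by group
    rw [this, hc]
    exact ha
  have hP : ((fun y : G => y⁻¹ * g * y) ⁻¹' (H : Set G)).Finite := by
    refine (Set.toFinite (H : Set G)).preimage' ?_
    rintro b -
    by_cases he : ∃ y0 : G, y0⁻¹ * g * y0 = b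
    · obtain ⟨y0, rfl⟩ := he
      refine Set.Finite.of_finite_image (f := fun c => c * y0⁻¹) (hC.subset ?_)
        (mul_left_injective _).injOn
      rintro _ ⟨z, hz, rfl⟩
      have hz : z⁻¹ * g * z = y0⁻¹ * g * y0 := hz
      change (z * y0⁻¹)⁻¹ * g * (z * y0⁻¹) = g
      have : (z * y0⁻¹)⁻¹ * g * (z * y0⁻¹) = y0 * (z⁻¹ * g * z) * y0⁻¹ := by group
      rw [this, hz]
      group
    · convert Set.finite_empty
      ext z
      simp only [Set.mem_preimage, Set.mem_singleton_iff, Set.mem_empty_iff_false, iff_false]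
      exact fun h => he ⟨z, h⟩
  refine Set.finite_univ_iff.mp ((hB.union hP).subset ?_)
  intro y _
  by_cases h : y⁻¹ * g * y ∈ H
  · exact Or.inr h
  · exact Or.inl h

/-- The idempotent attached to `H`. -/
theorem auxE_idem (hq : (Fintype.card H : K) ≠ 0) :
    ((Fintype.card H : K)⁻¹ • auxN K H) * ((Fintype.card H : K)⁻¹ • auxN K H) =
      (Fintype.card H : K)⁻¹ • auxN K H := by
  rw [smul_mul_smul_comm, auxN_sq, smul_smul, mul_assoc, inv_mul_cancel₀ hq, mul_one]

theorem auxE_ne_zero (hq : (Fintype.card H : K) ≠ 0) :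
    (Fintype.card H : K)⁻¹ • auxN K H ≠ 0 :=
  smul_ne_zero (inv_ne_zero hq) (auxN_ne H)

theorem auxE_one_sub (hq : (Fintype.card H : K) ≠ 0) {g : G} (hg : g ∈ H) (hg1 : g ≠ 1) :
    1 - (Fintype.card H : K)⁻¹ • auxN K H ≠ 0 := by
  classical
  intro h
  have := congrArg (fun t => t.coeff g) h
  simp [one_def, auxN_coeff, hg, Finsupp.single_apply, hg1.symm, hq] at this

theorem aux_K_zsq (hq : (Fintype.card H : K) ≠ 0) {g : G} (hg : g ∈ H) (hg1 : g ≠ 1)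
    (t : Kˣ) (ht : ¬ IsOfFinOrder t) :
    ∃ f : Multiplicative (ℤ × ℤ) →* (MonoidAlgebra K G)ˣ, Function.Injective f := by
  let ι : K →+* MonoidAlgebra K G := algebraMap K (MonoidAlgebra K G)
  let u : (MonoidAlgebra K G)ˣ := Units.map (ι : K →* MonoidAlgebra K G) t
  have hu : ∀ n : ℤ, ((u ^ n : (MonoidAlgebra K G)ˣ) : MonoidAlgebra K G)
      = algebraMap K _ ((t ^ n : Kˣ) : K) := by
    intro n
    simp only [u]
    rw [← map_zpow]
    rfl
  have key : ∀ (n : ℤ) (x : MonoidAlgebra K G), x ≠ 0 →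
      ((u ^ n : (MonoidAlgebra K G)ˣ) : MonoidAlgebra K G) * x = x → n = 0 := by
    intro n x hx h
    rw [hu, ← Algebra.smul_def] at h
    have h1 : ((t ^ n : Kˣ) : K) = 1 := smul_left_injective K hx (by simpa using h)
    by_contra hn
    exact ht (isOfFinOrder_iff_zpow_eq_one.mpr ⟨n, hn, Units.ext h1⟩)
  refine aux_zsq (auxE_idem H hq) u ?_ (fun n => key n _ (auxE_ne_zero H hq))
    (fun n => key n _ (auxE_one_sub H hq hg hg1))
  exact Algebra.commutes _ _

theorem aux_G_zsq [H.Normal] (hq : (Fintype.card H : K) ≠ 0) {g : G} (hg : g ∈ H) (hg1 : g ≠ 1)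
    (x : G) (hx : ¬ IsOfFinOrder x) :
    ∃ f : Multiplicative (ℤ × ℤ) →* (MonoidAlgebra K G)ˣ, Function.Injective f := by
  classical
  let u : (MonoidAlgebra K G)ˣ := Units.map (of K G) (toUnits x)
  have hu : ∀ n : ℤ, ((u ^ n : (MonoidAlgebra K G)ˣ) : MonoidAlgebra K G)
      = single (x ^ n) 1 := by
    intro n
    simp only [u]
    rw [← map_zpow, ← map_zpow]
    rfl
  have hH : ∀ n : ℤ, x ^ n ∈ H → n = 0 := by
    intro n hn
    by_contra hn0
    have : IsOfFinOrder (x ^ n) := by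
      have h1 : IsOfFinOrder (⟨x ^ n, hn⟩ : H) := isOfFinOrder_of_finite _
      exact (Submonoid.isOfFinOrder_coe (H := H.toSubmonoid)).mpr h1
    obtain ⟨m, hm, h⟩ := isOfFinOrder_iff_zpow_eq_one.mp this
    exact hx (isOfFinOrder_iff_zpow_eq_one.mpr ⟨n * m, mul_ne_zero hn0 hm, by rw [zpow_mul, h]⟩)
  refine aux_zsq (auxE_idem H hq) u ?_ ?_ ?_
  · rw [mul_smul_comm, auxN_central, smul_mul_assoc]
  · intro n h
    apply hH
    rw [hu] at h
    by_contra hc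
    have := congrArg (fun t => t.coeff (x ^ n)) h
    simp [coeff_single_mul_apply, auxN_coeff, hc, hq] at this
  · intro n h
    apply hH
    rw [hu] at h
    by_contra hc
    have := congrArg (fun t => t.coeff (x ^ n * g)) h
    have h2 : x ^ n * g ∉ H := fun h => hc ((H.mul_mem_cancel_right hg).mp h)
    have h3 : (1 : G) ≠ x ^ n * g := fun h => h2 (h ▸ H.one_mem)
    simp only [coeff_single_mul_apply] at this
    simp [auxN_coeff, h2, hg, one_def, Finsupp.single_apply, h3, hg1.symm, hq] at this

end

/-- **Theorem 2.**  Let `K` be a field of positive characteristic `p` and `G` a group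
with nontrivial torsion.  If the unit group `U(KG)` (a) contains no subgroup
isomorphic to `ℤ × ℤ`, (b) has all its torsion subgroups finite, and (c) is finitely
generated, then `K` and `G` are finite.  Conversely, if `K` and `G` are finite then
`U(KG)` is finite and (a), (b), (c) hold. -/
theorem units_group_algebra_positive_char {K G : Type*} [Field K] [Group G]
    (p : ℕ) [Fact p.Prime] [CharP K p]
    (htG : ∃ g : G, g ≠ 1 ∧ IsOfFinOrder g) :
    (((¬ ∃ f : Multiplicative (ℤ × ℤ) →* (MonoidAlgebra K G)ˣ, Function.Injective f)
        → (∀ H : Subgroup (MonoidAlgebra K G)ˣ, (∀ x ∈ H, IsOfFinOrder x) → Finite H)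
        → Group.FG (MonoidAlgebra K G)ˣ
        → Finite K ∧ Finite G))
    ∧ (Finite K → Finite G →
        Finite (MonoidAlgebra K G)ˣ
        ∧ (¬ ∃ f : Multiplicative (ℤ × ℤ) →* (MonoidAlgebra K G)ˣ, Function.Injective f)
        ∧ (∀ H : Subgroup (MonoidAlgebra K G)ˣ, (∀ x ∈ H, IsOfFinOrder x) → Finite H)
        ∧ Group.FG (MonoidAlgebra K G)ˣ) := by
  constructor
  · intro ha hb _
    have hp0 : 0 < p := (Fact.out : p.Prime).pos
    obtain ⟨g, hg1, hgf⟩ := htG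
    let H : Subgroup G := Subgroup.zpowers g
    have hg : g ∈ H := Subgroup.mem_zpowers g
    have : Finite H := hgf.finite_zpowers
    have : Fintype H := Fintype.ofFinite H
    constructor
    · by_cases hq : (Fintype.card H : K) = 0
      · exact aux_K_finite H hp0 hb hq
      · have htor : ∀ t : Kˣ, IsOfFinOrder t := fun t => by
          by_contra ht
          exact ha (aux_K_zsq H hq hg hg1 t ht)
        let ψ : Kˣ →* (MonoidAlgebra K G)ˣ :=
          Units.map ((algebraMap K (MonoidAlgebra K G) : K →+* _) : K →* MonoidAlgebra K G)
        have hψ : Function.Injective ψ :=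
          Units.map_injective (algebraMap K (MonoidAlgebra K G)).injective
        have hfin : Finite ψ.range := hb _ (by
          rintro _ ⟨t, rfl⟩
          exact ψ.isOfFinOrder (htor t))
        have : Finite Kˣ := Finite.of_injective ψ.rangeRestrict
          (ψ.rangeRestrict_injective_iff.mpr hψ)
        have hun : (Set.univ : Set K).Finite := by
          refine ((Set.finite_range (Units.val : Kˣ → K)).union (Set.finite_singleton 0)).subset ?_
          intro t _
          by_cases ht : t = 0
          · exact Or.inr ht
          · exact Or.inl ⟨Units.mk0 t ht, rfl⟩
        exact Set.finite_univ_iff.mp hun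
    · by_cases hn : ∀ a : G, a⁻¹ * g * a ∈ H
      · have hnorm : H.Normal := by
          constructor
          rintro _ ⟨k, rfl⟩ y
          have := H.zpow_mem (hn y⁻¹) k
          rw [inv_inv, conj_zpow] at this
          exact this
        by_cases hq : (Fintype.card H : K) = 0
        · exact aux_G_finite_p H hp0 hb hq
        · have htor : ∀ x : G, IsOfFinOrder x := fun x => by
            by_contra hx
            exact ha (aux_G_zsq H hq hg hg1 x hx)
          let ψ : G →* (MonoidAlgebra K G)ˣ :=
            (Units.map (MonoidAlgebra.of K G)).comp (toUnits : G ≃* Gˣ).toMonoidHom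
          have hψ : Function.Injective ψ :=
            (Units.map_injective MonoidAlgebra.of_injective).comp toUnits.injective
          have hfin : Finite ψ.range := hb _ (by
            rintro _ ⟨t, rfl⟩
            exact ψ.isOfFinOrder (htor t))
          exact Finite.of_injective ψ.rangeRestrict (ψ.rangeRestrict_injective_iff.mpr hψ)
      · push Not at hn
        obtain ⟨a, ha'⟩ := hn
        exact aux_conj H hp0 hb hg ha'
  · intro hK hG
    have : Finite (MonoidAlgebra K G) := 
      Finite.of_injective (fun (x : MonoidAlgebra K G) => (x.coeff : G → K))
        (DFunLike.coe_injective.comp MonoidAlgebra.coeff_injective)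
    have : Finite (MonoidAlgebra K G)ˣ := inferInstance
    refine ⟨this, ?_, fun H _ => inferInstance, inferInstance⟩
    rintro ⟨f, hf⟩
    have h1 : Finite (Multiplicative (ℤ × ℤ)) := Finite.of_injective f hf
    exact not_finite (Multiplicative (ℤ × ℤ))
end

section
/- Let G be a finite abelian group. Then the unit group U(ℤG) of the integral group ring ℤG decomposes as U(ℤG) = ±G × S_G: there is a free abelian subgroup S_G of U(ℤG) such that U(ℤG) is the internal direct product of the subgroup {±g : g ∈ G} of trivial units and S_G, and the rank of S_G equals (|G| + 1 + t₂ − 2l)/2, where t₂ is the number of elements of order 2 in G and l is the number of cyclic subgroups of G. -/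
/-- The subgroup of trivial units `±g` (`g ∈ G`) of the integral group ring `ℤG`. -/
noncomputable def trivialUnits (G : Type*) [CommGroup G] :
    Subgroup (MonoidAlgebra ℤ G)ˣ :=
  Subgroup.closure {u : (MonoidAlgebra ℤ G)ˣ |
    ∃ g : G, (u : MonoidAlgebra ℤ G) = MonoidAlgebra.of ℤ G g
      ∨ (u : MonoidAlgebra ℤ G) = - MonoidAlgebra.of ℤ G g}

open NumberField Module

/-- evaluation of a character on the group ring -/
noncomputable def charEval (k : Type*) [CommRing k] [Algebra k ℂ] {G : Type*} [CommGroup G]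
    (χ : G →* ℂˣ) : MonoidAlgebra k G →ₐ[k] ℂ :=
  MonoidAlgebra.lift k ℂ G ((Units.coeHom ℂ).comp χ)

theorem charEval_of (k : Type*) [CommRing k] [Algebra k ℂ] {G : Type*} [CommGroup G]
    (χ : G →* ℂˣ) (g : G) : charEval k χ (MonoidAlgebra.of k G g) = (χ g : ℂ) := by
  simp [charEval]

theorem charEval_eq_sum (k : Type*) [CommRing k] [Algebra k ℂ] {G : Type*} [CommGroup G] [Fintype G]
    (χ : G →* ℂˣ) (x : MonoidAlgebra k G) :
    charEval k χ x = ∑ g, x.coeff g • (χ g : ℂ) := by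
  rw [charEval, MonoidAlgebra.lift_apply, Finsupp.sum_fintype _ _ (by simp)]
  simp

theorem sum_char_eq_zero {G : Type*} [CommGroup G] [Finite G] [Fintype (G →* ℂˣ)] {g : G}
    (hg : g ≠ 1) : ∑ χ : G →* ℂˣ, (χ g : ℂ) = 0 := by
  obtain ⟨φ, hφ⟩ := CommGroup.exists_apply_ne_one_of_hasEnoughRootsOfUnity G ℂ hg
  have h1 : (φ g : ℂ) * ∑ χ : G →* ℂˣ, (χ g : ℂ) = ∑ χ : G →* ℂˣ, (χ g : ℂ) := by
    rw [Finset.mul_sum]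
    refine Fintype.sum_equiv (Equiv.mulLeft φ) _ _ fun χ => ?_
    simp
  have h2 : ((φ g : ℂ) - 1) * ∑ χ : G →* ℂˣ, (χ g : ℂ) = 0 := by rw [sub_mul, h1]; ring
  rcases mul_eq_zero.1 h2 with h | h
  · exact absurd (Units.ext (sub_eq_zero.1 h)) hφ
  · exact h

theorem charEval_injective {G : Type*} [CommGroup G] [Finite G] {x : MonoidAlgebra ℤ G}
    (hx : ∀ χ : G →* ℂˣ, charEval ℤ χ x = 0) : x = 0 := by
  classical
  have := Fintype.ofFinite G
  have := Fintype.ofFinite (G →* ℂˣ)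
  apply MonoidAlgebra.ext
  ext h
  have h1 : ∑ χ : G →* ℂˣ, (χ h⁻¹ : ℂ) * charEval ℤ χ x = 0 := by simp [hx]
  have h2 : ∑ χ : G →* ℂˣ, (χ h⁻¹ : ℂ) * charEval ℤ χ x
      = ∑ g, (x.coeff g : ℂ) * ∑ χ : G →* ℂˣ, (χ (h⁻¹ * g) : ℂ) := by
    simp_rw [charEval_eq_sum, Finset.mul_sum]
    rw [Finset.sum_comm]
    refine Finset.sum_congr rfl fun g _ => Finset.sum_congr rfl fun χ _ => ?_
    rw [map_mul, zsmul_eq_mul, Units.val_mul]; ring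
  rw [Finset.sum_eq_single h] at h2
  · rw [h1] at h2
    have hc : (Fintype.card (G →* ℂˣ) : ℂ) ≠ 0 := by simp
    simpa using h2.symm
  · intro g _ hg
    rw [sum_char_eq_zero, mul_zero]
    intro h'
    exact hg (inv_mul_eq_one.1 h').symm
  · simp

theorem norm_char {G : Type*} [CommGroup G] [Finite G] (χ : G →* ℂˣ) (g : G) :
    ‖(χ g : ℂ)‖ = 1 := by
  have h : (χ g : ℂ) ^ Nat.card G = 1 := by
    rw [← Units.val_pow_eq_pow_val, ← map_pow, pow_card_eq_one', map_one, Units.val_one]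
  exact Complex.norm_eq_one_of_pow_eq_one h Nat.card_pos.ne'

theorem conj_char {G : Type*} [CommGroup G] [Finite G] (χ : G →* ℂˣ) (g : G) :
    (starRingEnd ℂ) (χ g : ℂ) = (χ g⁻¹ : ℂ) := by
  rw [map_inv, Units.val_inv_eq_inv_val, Complex.inv_eq_conj (norm_char χ g)]

theorem torsion_unit_trivial {G : Type*} [CommGroup G] [Finite G] (u : (MonoidAlgebra ℤ G)ˣ)
    {n : ℕ} (hn : n ≠ 0) (hu : u ^ n = 1) :
    ∃ g : G, (u : MonoidAlgebra ℤ G) = MonoidAlgebra.of ℤ G g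
      ∨ (u : MonoidAlgebra ℤ G) = - MonoidAlgebra.of ℤ G g := by
  classical
  have := Fintype.ofFinite G
  set x : MonoidAlgebra ℤ G := (u : MonoidAlgebra ℤ G) with hx
  let y : MonoidAlgebra ℤ G := ∑ g, MonoidAlgebra.single g⁻¹ (x.coeff g)
  have hxn : x ^ n = 1 := by
    rw [hx, ← Units.val_pow_eq_pow_val, hu, Units.val_one]
  have hnorm : ∀ χ : G →* ℂˣ, ‖charEval ℤ χ x‖ = 1 := fun χ =>
    Complex.norm_eq_one_of_pow_eq_one (by rw [← map_pow, hxn, map_one]) hn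
  have hconj : ∀ χ : G →* ℂˣ, charEval ℤ χ y = (starRingEnd ℂ) (charEval ℤ χ x) := by
    intro χ
    rw [charEval_eq_sum ℤ χ x, map_sum, map_sum]
    refine Finset.sum_congr rfl fun g _ => ?_
    rw [charEval, MonoidAlgebra.lift_single, zsmul_eq_mul, zsmul_eq_mul, map_mul, conj_char]
    simp
  have hyx : y * x = 1 := by
    rw [← sub_eq_zero]
    apply charEval_injective
    intro χ
    rw [map_sub, map_mul, map_one, hconj, ← Complex.normSq_eq_conj_mul_self,
      Complex.normSq_eq_norm_sq, hnorm]
    simp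
  have hsum : ∑ g, x.coeff g ^ 2 = 1 := by
    have h := congrArg (fun z : MonoidAlgebra ℤ G => z.coeff 1) hyx
    simp only [y, Finset.sum_mul] at h
    simp only [MonoidAlgebra.coeff_one_one] at h
    rw [← h, MonoidAlgebra.coeff_sum, Finsupp.finsetSum_apply]
    refine Finset.sum_congr rfl fun g _ => ?_
    simp [sq]
  obtain ⟨g, hg⟩ : ∃ g, x.coeff g ≠ 0 := by
    by_contra! h
    simp [h] at hsum
  refine ⟨g, ?_⟩
  have h1 : x.coeff g ^ 2 + ∑ h ∈ Finset.univ.erase g, x.coeff h ^ 2 = 1 := by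
    rw [Finset.add_sum_erase _ (fun h => x.coeff h ^ 2) (Finset.mem_univ g), hsum]
  have h2 : 0 ≤ ∑ h ∈ Finset.univ.erase g, x.coeff h ^ 2 :=
    Finset.sum_nonneg fun _ _ => sq_nonneg _
  have h3 : 0 < x.coeff g ^ 2 := by positivity
  have h4 : x.coeff g ^ 2 = 1 := by omega
  have h5 : ∑ h ∈ Finset.univ.erase g, x.coeff h ^ 2 = 0 := by omega
  have h6 : ∀ h, h ≠ g → x.coeff h = 0 := by
    intro h hh
    have := (Finset.sum_eq_zero_iff_of_nonneg (fun _ _ => sq_nonneg _)).1 h5 h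
      (Finset.mem_erase.2 ⟨hh, Finset.mem_univ _⟩)
    exact pow_eq_zero_iff (two_ne_zero) |>.1 this
  rcases (sq_eq_sq_iff_eq_or_eq_neg.1 (h4.trans (one_pow 2).symm)) with h | h
  · left
    apply MonoidAlgebra.ext
    ext k
    by_cases hk : k = g
    · subst hk; simp [h]
    · simp [h6 k hk, Ne.symm hk]
  · right
    apply MonoidAlgebra.ext
    ext k
    by_cases hk : k = g
    · subst hk; simp [h]
    · simp [h6 k hk, Ne.symm hk]

theorem trivialUnits_eq_torsion (G : Type*) [CommGroup G] [Finite G] :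
    trivialUnits G = CommGroup.torsion (MonoidAlgebra ℤ G)ˣ := by
  apply le_antisymm
  · rw [trivialUnits, Subgroup.closure_le]
    rintro u ⟨g, hu⟩
    rw [SetLike.mem_coe, CommGroup.mem_torsion, isOfFinOrder_iff_pow_eq_one]
    refine ⟨2 * Nat.card G, Nat.mul_pos two_pos Nat.card_pos, ?_⟩
    apply Units.ext
    rw [Units.val_pow_eq_pow_val, pow_mul]
    have h : (u : MonoidAlgebra ℤ G) ^ 2 = MonoidAlgebra.of ℤ G (g ^ 2) := by
      rcases hu with hu | hu <;> rw [hu] <;> simp [MonoidAlgebra.single_pow]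
    rw [h, ← map_pow, pow_card_eq_one', map_one, Units.val_one]
  · intro u hu
    rw [CommGroup.mem_torsion, isOfFinOrder_iff_pow_eq_one] at hu
    obtain ⟨n, hn, hu⟩ := hu
    exact Subgroup.subset_closure (torsion_unit_trivial u hn.ne' hu)

theorem char_range_gen {G : Type*} [CommGroup G] [Finite G] (χ : G →* ℂˣ) :
    ∃ g₀ : G, ∀ g, ∃ e : ℕ, χ g = χ g₀ ^ e := by
  have : Finite χ.range := (Set.finite_range χ).to_subtype
  have : IsCyclic χ.range := isCyclic_subgroup_units _
  obtain ⟨⟨z, g₀, hz⟩, h⟩ := IsCyclic.exists_generator (α := χ.range)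
  refine ⟨g₀, fun g => ?_⟩
  have h1 := h ⟨χ g, g, rfl⟩
  rw [← mem_powers_iff_mem_zpowers] at h1
  obtain ⟨e, he⟩ := h1
  refine ⟨e, ?_⟩
  have := congrArg Subtype.val he
  rw [hz]
  exact this.symm

theorem mem_zpowers_of_ker_le {G : Type*} [CommGroup G] [Finite G] {χ ψ : G →* ℂˣ}
    (h : RingHom.ker (charEval ℚ χ) ≤ RingHom.ker (charEval ℚ ψ)) :
    ψ ∈ Subgroup.zpowers χ := by
  obtain ⟨g₀, hg₀⟩ := char_range_gen χ
  have key : ∀ a b : G, χ a = χ b → ψ a = ψ b := by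
    intro a b hab
    have h1 : MonoidAlgebra.of ℚ G a - MonoidAlgebra.of ℚ G b ∈ RingHom.ker (charEval ℚ χ) := by
      rw [RingHom.mem_ker, map_sub, charEval_of, charEval_of, hab, sub_self]
    have h2 := h h1
    rw [RingHom.mem_ker, map_sub, charEval_of, charEval_of, sub_eq_zero] at h2
    exact Units.ext h2
  have hpos : 0 < orderOf (χ g₀) := (MonoidHom.isOfFinOrder χ (isOfFinOrder_of_finite g₀)).orderOf_pos
  have hprim : IsPrimitiveRoot (χ g₀ : ℂ) (orderOf (χ g₀)) :=
    IsPrimitiveRoot.coe_units_iff.2 (IsPrimitiveRoot.orderOf _)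
  have h1 : ψ g₀ ^ orderOf (χ g₀) = 1 := by
    rw [← map_pow, ← map_one ψ]
    apply key
    rw [map_pow, pow_orderOf_eq_one, map_one]
  have : NeZero (orderOf (χ g₀)) := ⟨hpos.ne'⟩
  obtain ⟨k, -, hk⟩ := hprim.eq_pow_of_pow_eq_one (ξ := (ψ g₀ : ℂ)) (by
    rw [← Units.val_pow_eq_pow_val, h1, Units.val_one])
  have hk' : χ g₀ ^ k = ψ g₀ := Units.ext (by rw [Units.val_pow_eq_pow_val, hk])
  suffices hs : χ ^ k = ψ from hs ▸ Subgroup.npow_mem_zpowers χ k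
  apply MonoidHom.ext
  intro g
  obtain ⟨e, he⟩ := hg₀ g
  have h2 : ψ g = ψ (g₀ ^ e) := key _ _ (by rw [he, map_pow])
  rw [h2, map_pow, ← hk', MonoidHom.pow_apply, he, ← pow_mul, ← pow_mul, mul_comm]

theorem ker_le_of_mem_zpowers {G : Type*} [CommGroup G] [Finite G] {χ ψ : G →* ℂˣ}
    (h : ψ ∈ Subgroup.zpowers χ) (h' : χ ∈ Subgroup.zpowers ψ) :
    RingHom.ker (charEval ℚ χ) ≤ RingHom.ker (charEval ℚ ψ) := by
  have := Fintype.ofFinite G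
  rw [← mem_powers_iff_mem_zpowers] at h h'
  obtain ⟨k, hk⟩ := h
  obtain ⟨j, hj⟩ := h'
  change χ ^ k = ψ at hk
  change ψ ^ j = χ at hj
  obtain ⟨g₀, hg₀⟩ := char_range_gen χ
  choose e he using hg₀
  have hpos : 0 < orderOf (χ g₀) := (MonoidHom.isOfFinOrder χ (isOfFinOrder_of_finite g₀)).orderOf_pos
  have hprim : IsPrimitiveRoot (χ g₀ : ℂ) (orderOf (χ g₀)) :=
    IsPrimitiveRoot.coe_units_iff.2 (IsPrimitiveRoot.orderOf _)
  have hord : orderOf (ψ g₀) = orderOf (χ g₀) := by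
    apply Nat.dvd_antisymm
    · rw [← hk, MonoidHom.pow_apply]
      exact orderOf_pow_dvd k
    · conv_lhs => rw [← hj, MonoidHom.pow_apply]
      exact orderOf_pow_dvd j
  have hprim' : IsPrimitiveRoot (ψ g₀ : ℂ) (orderOf (χ g₀)) :=
    IsPrimitiveRoot.coe_units_iff.2 (hord ▸ IsPrimitiveRoot.orderOf _)
  have hψ : ∀ g, ψ g = ψ g₀ ^ e g := by
    intro g
    rw [← hk, MonoidHom.pow_apply, MonoidHom.pow_apply, he, ← pow_mul, ← pow_mul, mul_comm]
  have hmin : minpoly ℚ (χ g₀ : ℂ) = minpoly ℚ (ψ g₀ : ℂ) := by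
    rw [← Polynomial.cyclotomic_eq_minpoly_rat hprim hpos,
      ← Polynomial.cyclotomic_eq_minpoly_rat hprim' hpos]
  intro x hx
  rw [RingHom.mem_ker] at hx ⊢
  let P : Polynomial ℚ := ∑ g, Polynomial.C (x.coeff g) * Polynomial.X ^ e g
  have h1 : Polynomial.aeval (χ g₀ : ℂ) P = charEval ℚ χ x := by
    rw [charEval_eq_sum, map_sum]
    refine Finset.sum_congr rfl fun g _ => ?_
    rw [he g]
    simp [Algebra.smul_def]
  have h2 : Polynomial.aeval (ψ g₀ : ℂ) P = charEval ℚ ψ x := by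
    rw [charEval_eq_sum, map_sum]
    refine Finset.sum_congr rfl fun g _ => ?_
    rw [hψ g]
    simp [Algebra.smul_def]
  rw [← h2]
  rw [← h1, ← minpoly.dvd_iff, hmin, minpoly.dvd_iff] at hx
  exact hx

theorem ker_eq_iff {G : Type*} [CommGroup G] [Finite G] {χ ψ : G →* ℂˣ} :
    RingHom.ker (charEval ℚ χ) = RingHom.ker (charEval ℚ ψ) ↔
      Subgroup.zpowers χ = Subgroup.zpowers ψ := by
  constructor
  · intro h
    apply le_antisymm
    · rw [Subgroup.zpowers_le]; exact mem_zpowers_of_ker_le h.ge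
    · rw [Subgroup.zpowers_le]; exact mem_zpowers_of_ker_le h.le
  · intro h
    have h1 : ψ ∈ Subgroup.zpowers χ := h ▸ Subgroup.mem_zpowers ψ
    have h2 : χ ∈ Subgroup.zpowers ψ := h ▸ Subgroup.mem_zpowers χ
    exact le_antisymm (ker_le_of_mem_zpowers h1 h2) (ker_le_of_mem_zpowers h2 h1)

/-- If every unit of a ring `O` has a power coming from a unit of a subring `R`, ranks agree. -/
theorem unit_rank_of_subring {R O : Type*} [CommRing R] [CommRing O] (f : R →+* O)
    (hf : Function.Injective f) [Module.Finite ℤ O] [Module.Finite ℤ (Additive Oˣ)]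
    (N : ℕ) (hN : N ≠ 0) (hfN : ∀ y : O, ∃ x : R, f x = (N : O) * y) :
    Module.Finite ℤ (Additive Rˣ) ∧
      finrank ℤ (Additive Rˣ) = finrank ℤ (Additive Oˣ) := by
  let F : Additive Rˣ →ₗ[ℤ] Additive Oˣ := (Units.map (f : R →* O)).toAdditive.toIntLinearMap
  have hF : Function.Injective F := by
    intro a b hab
    exact Units.map_injective hf hab
  have hfin : Module.Finite ℤ (Additive Rˣ) := Module.Finite.of_injective F hF
  refine ⟨hfin, ?_⟩
  let I : Ideal O := Ideal.span {(N : O)}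
  have : Finite (O ⧸ I) := by
    have : Module.Finite ℤ (O ⧸ I) :=
      Module.Finite.of_surjective (Ideal.Quotient.mk I).toAddMonoidHom.toIntLinearMap
        Ideal.Quotient.mk_surjective
    apply Module.finite_of_fg_torsion
    intro x
    obtain ⟨y, rfl⟩ := Ideal.Quotient.mk_surjective x
    refine ⟨⟨(N : ℤ), by simpa using hN⟩, ?_⟩
    change (N : ℤ) • (Ideal.Quotient.mk I y) = 0
    rw [← map_zsmul, Ideal.Quotient.eq_zero_iff_mem, Ideal.mem_span_singleton]
    exact ⟨y, by simp⟩
  let k := Nat.card (O ⧸ I)ˣ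
  have hk : k ≠ 0 := Nat.card_pos.ne'
  have key : ∀ u : Oˣ, ∃ x : R, f x = ((u ^ k : Oˣ) : O) := by
    intro u
    have h1 : (Units.map (Ideal.Quotient.mk I : O →* O ⧸ I) u) ^ k = 1 := pow_card_eq_one'
    have h2 : Ideal.Quotient.mk I ((u ^ k : Oˣ) : O) = Ideal.Quotient.mk I 1 := by
      have := congrArg Units.val h1
      simpa using this
    rw [Ideal.Quotient.eq, Ideal.mem_span_singleton] at h2
    obtain ⟨y, hy⟩ := h2
    obtain ⟨x, hx⟩ := hfN y
    refine ⟨x + 1, ?_⟩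
    rw [map_add, hx, map_one, ← hy]; ring
  have hquot : Module.IsTorsion ℤ (Additive Oˣ ⧸ LinearMap.range F) := by
    intro x
    obtain ⟨u, rfl⟩ := Submodule.mkQ_surjective (LinearMap.range F) x
    refine ⟨⟨(k : ℤ), by simpa using hk⟩, ?_⟩
    change (k : ℤ) • (Submodule.mkQ (LinearMap.range F) u) = 0
    rw [← map_zsmul, Submodule.mkQ_apply, Submodule.Quotient.mk_eq_zero]
    obtain ⟨x, hx⟩ := key u.toMul
    obtain ⟨y, hy⟩ := key (u.toMul)⁻¹
    have hxy : x * y = 1 := by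
      apply hf
      rw [map_mul, hx, hy, ← Units.val_mul, ← mul_pow]; simp
    refine ⟨Additive.ofMul (⟨x, y, hxy, by rw [mul_comm, hxy]⟩ : Rˣ), ?_⟩
    rw [natCast_zsmul]
    apply Additive.toMul.injective
    apply Units.ext
    exact hx
  have h1 := (LinearMap.range F).finrank_quotient_add_finrank
  have h0 : finrank ℤ (Additive Oˣ ⧸ LinearMap.range F) = 0 := by
    rw [finrank, Module.rank_eq_zero_iff_isTorsion.2 hquot]; simp
  rw [h0, zero_add, LinearMap.finrank_range_of_inj hF] at h1
  exact h1

theorem finrank_pi_int {ι : Type*} [Fintype ι] (M : ι → Type*) [∀ i, AddCommGroup (M i)]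
    [∀ i, Module.Finite ℤ (M i)] : finrank ℤ (∀ i, M i) = ∑ i, finrank ℤ (M i) := by
  classical
  let Q : (∀ i, M i) →ₗ[ℤ] (∀ i, M i ⧸ Submodule.torsion ℤ (M i)) :=
    LinearMap.pi fun i => (Submodule.mkQ (Submodule.torsion ℤ (M i))).comp (LinearMap.proj i)
  have hQ : Function.Surjective Q := by
    intro v
    have : ∀ i, ∃ u, Submodule.mkQ (Submodule.torsion ℤ (M i)) u = v i :=
      fun i => Submodule.mkQ_surjective _ (v i)
    choose u hu using this
    exact ⟨u, funext hu⟩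
  have hker : Module.IsTorsion ℤ (LinearMap.ker Q) := by
    intro x
    have hx : ∀ i, ∃ n : ℤ, n ≠ 0 ∧ n • (x.1 i) = 0 := by
      intro i
      have h : Q x.1 = 0 := x.2
      have h2 : Submodule.mkQ (Submodule.torsion ℤ (M i)) (x.1 i) = 0 := congrFun h i
      rw [Submodule.mkQ_apply, Submodule.Quotient.mk_eq_zero, Submodule.mem_torsion_iff] at h2
      obtain ⟨n, hn⟩ := h2
      exact ⟨n.1, nonZeroDivisors.ne_zero n.2, hn⟩
    choose n hn h using hx
    refine ⟨⟨∏ i, n i, by simpa using Finset.prod_ne_zero_iff.2 fun i _ => hn i⟩, ?_⟩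
    change (∏ i, n i) • x = 0
    apply Subtype.ext
    funext i
    change (∏ i, n i) • x.1 i = 0
    rw [← Finset.prod_erase_mul _ _ (Finset.mem_univ i), mul_smul, h, smul_zero]
  have h0 : finrank ℤ (LinearMap.ker Q) = 0 := by
    rw [finrank, Module.rank_eq_zero_iff_isTorsion.2 hker]; simp
  have h1 := (LinearMap.ker Q).finrank_quotient_add_finrank
  rw [h0, add_zero, (Q.quotKerEquivOfSurjective hQ).finrank_eq, Module.finrank_pi_fintype] at h1
  rw [← h1]
  exact Finset.sum_congr rfl fun i _ => finrank_quotient_eq_of_le_torsion le_rfl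

theorem unit_rank_pi {ι : Type*} [Fintype ι] (K : ι → Type*) [∀ i, Field (K i)]
    [∀ i, NumberField (K i)] :
    Module.Finite ℤ (Additive (∀ i, 𝓞 (K i))ˣ) ∧
      finrank ℤ (Additive (∀ i, 𝓞 (K i))ˣ) = ∑ i, Units.rank (K i) := by
  let e : Additive (∀ i, 𝓞 (K i))ˣ ≃ₗ[ℤ] (∀ i, Additive (𝓞 (K i))ˣ) :=
    AddEquiv.toIntLinearEquiv (AddEquiv.mk'
      { toFun := fun u i => Additive.ofMul ((MulEquiv.piUnits u.toMul) i)
        invFun := fun v => Additive.ofMul (MulEquiv.piUnits.symm (fun i => (v i).toMul))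
        left_inv := fun u => by simp
        right_inv := fun v => by
          funext i
          simp }
      (by intro a b; funext i; simp))
  refine ⟨Module.Finite.equiv e.symm, ?_⟩
  rw [e.finrank_eq]
  rw [finrank_pi_int]
  exact Finset.sum_congr rfl fun i _ => Units.finrank_eq (K i)

theorem unit_rank_of_order {ι : Type*} [Fintype ι] (K : ι → Type*) [∀ i, Field (K i)]
    [∀ i, NumberField (K i)] {R : Type*} [CommRing R] [Module.Finite ℤ R]
    (f : R →+* ∀ i, K i) (hf : Function.Injective f)
    (hd : ∀ y : ∀ i, K i, ∃ n : ℤ, n ≠ 0 ∧ ∃ x, f x = n • y) :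
    Module.Finite ℤ (Additive Rˣ) ∧
      finrank ℤ (Additive Rˣ) = ∑ i, Units.rank (K i) := by
  have hint : ∀ x i, IsIntegral ℤ (f x i) := fun x i =>
    map_isIntegral_int ((Pi.evalRingHom K i).comp f) (Algebra.IsIntegral.isIntegral x)
  let g : R →+* ∀ i, 𝓞 (K i) := RingHom.pi fun i =>
    ((Pi.evalRingHom K i).comp f).codRestrict (integralClosure ℤ (K i)) (fun x => hint x i)
  have hgf : ∀ x i, ((g x i : 𝓞 (K i)) : K i) = f x i := fun x i => rfl
  have hg : Function.Injective g := by
    intro x y h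
    apply hf
    funext i
    rw [← hgf, h, hgf]
  obtain ⟨hfin, hrank⟩ := unit_rank_pi K
  obtain ⟨s, hs⟩ := (Module.Finite.fg_top : (⊤ : Submodule ℤ (∀ i, 𝓞 (K i))).FG)
  have h1 : ∀ y : ∀ i, 𝓞 (K i), ∃ n : ℤ, n ≠ 0 ∧ ∃ x, g x = n • y := by
    intro y
    obtain ⟨n, hn, x, hx⟩ := hd (fun i => (y i : K i))
    refine ⟨n, hn, x, ?_⟩
    funext i
    apply RingOfIntegers.ext
    rw [hgf, hx]
    simp
  choose n hn h2 using h1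
  let N : ℤ := ∏ y ∈ s, n y
  have hN : N ≠ 0 := Finset.prod_ne_zero_iff.2 fun y _ => hn y
  have h3 : ∀ y : ∀ i, 𝓞 (K i), N • y ∈ LinearMap.range g.toAddMonoidHom.toIntLinearMap := by
    intro y
    have hy : y ∈ Submodule.span ℤ (s : Set (∀ i, 𝓞 (K i))) := hs ▸ Submodule.mem_top
    induction hy using Submodule.span_induction with
    | mem y hy =>
      obtain ⟨x, hx⟩ := h2 y
      obtain ⟨c, hc⟩ := Finset.dvd_prod_of_mem n hy
      refine ⟨c • x, ?_⟩
      rw [map_zsmul]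
      change c • g x = _
      rw [hx, smul_smul, mul_comm c, ← hc]
    | zero => simp
    | add a b _ _ ha hb => rw [smul_add]; exact add_mem ha hb
    | smul c a _ ha => rw [smul_comm]; exact Submodule.smul_mem _ _ ha
  have := unit_rank_of_subring g hg N.natAbs (by simpa using hN) (by
    intro y
    have : ((N.natAbs : ℕ) : ∀ i, 𝓞 (K i)) * y ∈
        LinearMap.range g.toAddMonoidHom.toIntLinearMap := by
      rcases Int.natAbs_eq N with h | h
      · have := h3 y
        rw [h] at this
        simpa using this
      · have := neg_mem (h3 y)
        rw [h] at this
        simpa using this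
    obtain ⟨x, hx⟩ := this
    exact ⟨x, hx⟩)
  rw [hrank] at this
  exact this

theorem charEval_bij (G : Type*) [CommGroup G] [Finite G] :
    Function.Bijective (fun χ : G →* ℂˣ => (charEval ℚ χ : MonoidAlgebra ℚ G →+* ℂ)) := by
  constructor
  · intro χ ψ h
    apply MonoidHom.ext
    intro g
    apply Units.ext
    have h1 := congrArg (fun φ : MonoidAlgebra ℚ G →+* ℂ => φ (MonoidAlgebra.of ℚ G g)) h
    have h2 : charEval ℚ χ (MonoidAlgebra.of ℚ G g) = charEval ℚ ψ (MonoidAlgebra.of ℚ G g) := h1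
    rwa [charEval_of, charEval_of] at h2
  · intro φ
    refine ⟨MonoidHom.toHomUnits ((φ : MonoidAlgebra ℚ G →* ℂ).comp (MonoidAlgebra.of ℚ G)), ?_⟩
    have h : charEval ℚ (MonoidHom.toHomUnits
        ((φ : MonoidAlgebra ℚ G →* ℂ).comp (MonoidAlgebra.of ℚ G))) = φ.toRatAlgHom := by
      refine MonoidAlgebra.algHom_ext' (MonoidHom.ext fun g => ?_) (Subsingleton.elim _ _)
      change charEval ℚ _ (MonoidAlgebra.of ℚ G g) = φ (MonoidAlgebra.of ℚ G g)
      rw [charEval_of]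
      rfl
    change ((charEval ℚ _ : MonoidAlgebra ℚ G →ₐ[ℚ] ℂ) : MonoidAlgebra ℚ G →+* ℂ) = φ
    rw [h]
    rfl

/-- Embeddings of the residue fields, as ring homs. -/
theorem quotient_hom_bij (A : Type*) [CommRing A] [IsArtinianRing A] :
    Function.Bijective (fun p : Σ m : MaximalSpectrum A, (A ⧸ m.asIdeal →+* ℂ) =>
      p.2.comp (Ideal.Quotient.mk p.1.asIdeal)) := by
  have hker : ∀ p : Σ m : MaximalSpectrum A, (A ⧸ m.asIdeal →+* ℂ),
      RingHom.ker (p.2.comp (Ideal.Quotient.mk p.1.asIdeal)) = p.1.asIdeal := by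
    rintro ⟨m, ψ⟩
    have := m.isMaximal
    let _ := Ideal.Quotient.field m.asIdeal
    have hinj : Function.Injective ψ := RingHom.injective ψ
    ext x
    rw [RingHom.mem_ker, RingHom.comp_apply, map_eq_zero_iff ψ hinj, Ideal.Quotient.eq_zero_iff_mem]
  constructor
  · rintro ⟨m, ψ⟩ ⟨m', ψ'⟩ h
    have h1 := hker ⟨m, ψ⟩
    have h2 := hker ⟨m', ψ'⟩
    simp only at h h1 h2
    rw [h, h2] at h1
    obtain rfl : m' = m := MaximalSpectrum.ext h1
    congr 1
    exact Ideal.Quotient.ringHom_ext h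
  · intro φ
    have hp : (RingHom.ker φ).IsPrime := RingHom.ker_isPrime φ
    refine ⟨⟨⟨RingHom.ker φ, inferInstance⟩, RingHom.kerLift φ⟩, ?_⟩
    apply RingHom.ext
    intro x
    rfl

theorem card_maximalSpectrum (G : Type*) [CommGroup G] [Finite G] :
    Nat.card (MaximalSpectrum (MonoidAlgebra ℚ G)) =
      Nat.card {H : Subgroup G // IsCyclic H} := by
  obtain ⟨e⟩ := CommGroup.monoidHom_mulEquiv_of_hasEnoughRootsOfUnity G ℂ
  have h1 : Nat.card {H : Subgroup (G →* ℂˣ) // IsCyclic H} =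
      Nat.card {H : Subgroup G // IsCyclic H} := by
    refine Nat.card_congr (e.mapSubgroup.toEquiv.subtypeEquiv fun H => ?_)
    exact (e.subgroupMap H).isCyclic
  rw [← h1]
  -- both are quotients of the set of characters by the same relation
  let a : (G →* ℂˣ) → MaximalSpectrum (MonoidAlgebra ℚ G) := fun χ =>
    ⟨RingHom.ker (charEval ℚ χ), by
      have : (RingHom.ker (charEval ℚ χ)).IsPrime := RingHom.ker_isPrime _
      infer_instance⟩
  let b : (G →* ℂˣ) → {H : Subgroup (G →* ℂˣ) // IsCyclic H} := fun χ =>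
    ⟨Subgroup.zpowers χ, inferInstance⟩
  have ha : Function.Surjective a := by
    intro m
    have := m.isMaximal
    let _ := Ideal.Quotient.field m.asIdeal
    obtain ⟨φ⟩ : Nonempty ((MonoidAlgebra ℚ G ⧸ m.asIdeal) →ₐ[ℚ] ℂ) :=
      ⟨IsAlgClosed.lift⟩
    obtain ⟨χ, hχ⟩ := (charEval_bij G).2 ((φ : _ →+* ℂ).comp (Ideal.Quotient.mk m.asIdeal))
    refine ⟨χ, MaximalSpectrum.ext ?_⟩
    change RingHom.ker (charEval ℚ χ : MonoidAlgebra ℚ G →+* ℂ) = _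
    simp only at hχ
    rw [hχ]
    ext x
    rw [RingHom.mem_ker, RingHom.comp_apply]
    have hinj : Function.Injective (φ : (MonoidAlgebra ℚ G ⧸ m.asIdeal) →+* ℂ) :=
      RingHom.injective _
    rw [map_eq_zero_iff _ hinj, Ideal.Quotient.eq_zero_iff_mem]
  have hb : Function.Surjective b := by
    rintro ⟨H, hH⟩
    obtain ⟨χ, hχ⟩ := (Subgroup.isCyclic_iff_exists_zpowers_eq_top H).1 hH
    exact ⟨χ, Subtype.ext hχ⟩
  have hab : ∀ χ ψ, a χ = a ψ ↔ b χ = b ψ := by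
    intro χ ψ
    rw [MaximalSpectrum.ext_iff, Subtype.ext_iff]
    exact ker_eq_iff
  refine Nat.card_congr (Equiv.ofBijective (fun m => b (Function.surjInv ha m)) ⟨?_, ?_⟩)
  · intro m m' h
    have := (hab _ _).2 h
    rwa [Function.surjInv_eq ha, Function.surjInv_eq ha] at this
  · intro H
    obtain ⟨χ, rfl⟩ := hb H
    refine ⟨a χ, ?_⟩
    exact (hab _ _).1 (Function.surjInv_eq ha _)

theorem two_rank (K : Type*) [Field K] [NumberField K] :
    2 * Units.rank K + 2 = Nat.card (K →+* ℂ) +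
      Nat.card {φ : K →+* ℂ // ComplexEmbedding.IsReal φ} := by
  classical
  have h1 := InfinitePlace.card_add_two_mul_card_eq_rank K
  have h2 := InfinitePlace.card_real_embeddings K
  have h3 := Embeddings.card K ℂ
  have h4 := InfinitePlace.card_eq_nrRealPlaces_add_nrComplexPlaces K
  have h5 : 0 < Fintype.card (InfinitePlace K) := Fintype.card_pos
  rw [Nat.card_eq_fintype_card, Nat.card_eq_fintype_card, Units.rank]
  omega

theorem card_involutions {G : Type*} [CommGroup G] [Finite G] :
    Nat.card {g : G // g ^ 2 = 1} = 1 + Nat.card {g : G // orderOf g = 2} := by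
  classical
  have : Fintype G := Fintype.ofFinite G
  rw [Nat.card_eq_fintype_card, Nat.card_eq_fintype_card, Fintype.card_subtype,
    Fintype.card_subtype]
  have : (Finset.univ.filter fun g : G => g ^ 2 = 1) =
      insert 1 (Finset.univ.filter fun g : G => orderOf g = 2) := by
    ext g
    simp only [Finset.mem_filter, Finset.mem_univ, true_and, Finset.mem_insert]
    have h2 : Fact (Nat.Prime 2) := ⟨Nat.prime_two⟩
    constructor
    · intro h
      by_cases h1 : g = 1
      · exact Or.inl h1
      · exact Or.inr (orderOf_eq_prime h h1)
    · rintro (rfl | h)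
      · simp
      · rw [← h, pow_orderOf_eq_one]
  rw [this, Finset.card_insert_of_notMem (by simp), add_comm]

theorem charEval_real_iff {G : Type*} [CommGroup G] [Finite G] (χ : G →* ℂˣ) :
    (starRingEnd ℂ).comp (charEval ℚ χ : MonoidAlgebra ℚ G →+* ℂ) =
      (charEval ℚ χ : MonoidAlgebra ℚ G →+* ℂ) ↔ χ ^ 2 = 1 := by
  have h1 : (starRingEnd ℂ).comp (charEval ℚ χ : MonoidAlgebra ℚ G →+* ℂ) =
      (charEval ℚ χ⁻¹ : MonoidAlgebra ℚ G →+* ℂ) := by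
    have : ((starRingEnd ℂ).comp (charEval ℚ χ : MonoidAlgebra ℚ G →+* ℂ)).toRatAlgHom =
        charEval ℚ χ⁻¹ := by
      refine MonoidAlgebra.algHom_ext' (MonoidHom.ext fun g => ?_) (Subsingleton.elim _ _)
      change (starRingEnd ℂ) (charEval ℚ χ (MonoidAlgebra.of ℚ G g)) =
        charEval ℚ χ⁻¹ (MonoidAlgebra.of ℚ G g)
      rw [charEval_of, charEval_of, conj_char, map_inv, MonoidHom.inv_apply]
    rw [← this]
    rfl
  rw [h1, (charEval_bij G).1.eq_iff (a := χ⁻¹) (b := χ), sq]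
  exact inv_eq_iff_mul_eq_one (a := χ) (b := χ)

theorem rank_count (G : Type*) [CommGroup G] [Finite G] {ι : Type*} [Fintype ι]
    (K : ι → Type*) [∀ i, Field (K i)] [∀ i, NumberField (K i)]
    (π : ∀ i, MonoidAlgebra ℚ G →+* K i) (hπ : ∀ i, Function.Surjective (π i))
    (hT : Function.Bijective (fun p : Σ i, (K i →+* ℂ) => p.2.comp (π p.1))) :
    2 * ∑ i, Units.rank (K i) + 2 * Nat.card ι =
      Nat.card G + 1 + Nat.card {g : G // orderOf g = 2} := by
  obtain ⟨e⟩ := CommGroup.monoidHom_mulEquiv_of_hasEnoughRootsOfUnity G ℂ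
  let E : (Σ i, (K i →+* ℂ)) ≃ (G →* ℂˣ) :=
    (Equiv.ofBijective _ hT).trans (Equiv.ofBijective _ (charEval_bij G)).symm
  have hE : ∀ p, (charEval ℚ (E p) : MonoidAlgebra ℚ G →+* ℂ) = p.2.comp (π p.1) := fun p =>
    (Equiv.ofBijective _ (charEval_bij G)).apply_symm_apply (p.2.comp (π p.1))
  have hreal : ∀ p : Σ i, (K i →+* ℂ), ComplexEmbedding.IsReal p.2 ↔ (e (E p)) ^ 2 = 1 := by
    intro p
    rw [← map_pow, map_eq_one_iff e e.injective, ← charEval_real_iff, hE]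
    constructor
    · intro h
      apply RingHom.ext
      intro x
      exact congrArg (fun φ : K p.1 →+* ℂ => φ (π p.1 x)) h
    · intro h
      apply RingHom.ext
      intro y
      obtain ⟨x, rfl⟩ := hπ p.1 y
      exact congrArg (fun φ : MonoidAlgebra ℚ G →+* ℂ => φ x) h
  have h1 : ∑ i, Nat.card (K i →+* ℂ) = Nat.card G := by
    rw [← Nat.card_sigma]
    exact Nat.card_congr (E.trans e.toEquiv)
  have h2 : ∑ i, Nat.card {φ : K i →+* ℂ // ComplexEmbedding.IsReal φ} =
      1 + Nat.card {g : G // orderOf g = 2} := by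
    rw [← Nat.card_sigma, ← card_involutions]
    let E' : (Σ i, {φ : K i →+* ℂ // ComplexEmbedding.IsReal φ}) ≃
        {p : Σ i, (K i →+* ℂ) // ComplexEmbedding.IsReal p.2} :=
      { toFun := fun q => ⟨⟨q.1, q.2.1⟩, q.2.2⟩
        invFun := fun q => ⟨q.1.1, q.1.2, q.2⟩
        left_inv := fun _ => rfl
        right_inv := fun _ => rfl }
    exact Nat.card_congr (E'.trans ((E.trans e.toEquiv).subtypeEquiv hreal))
  have h3 : ∑ i, (2 * Units.rank (K i) + 2) = ∑ i, (Nat.card (K i →+* ℂ) +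
      Nat.card {φ : K i →+* ℂ // ComplexEmbedding.IsReal φ}) :=
    Finset.sum_congr rfl fun i _ => two_rank (K i)
  rw [Finset.sum_add_distrib, Finset.sum_add_distrib, h1, h2, ← Finset.mul_sum] at h3
  simp only [Finset.sum_const, Finset.card_univ, smul_eq_mul] at h3
  rw [Nat.card_eq_fintype_card (α := ι)]
  omega

theorem exists_free_complement (U : Type*) [CommGroup U] [Module.Finite ℤ (Additive U)] :
    ∃ S : Subgroup U, Nonempty (S ≃* Multiplicative (Fin (finrank ℤ (Additive U)) → ℤ)) ∧
      CommGroup.torsion U ⊓ S = ⊥ ∧ CommGroup.torsion U ⊔ S = ⊤ := by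
  let T := Submodule.torsion ℤ (Additive U)
  have hT : ∀ u : U, Additive.ofMul u ∈ T ↔ u ∈ CommGroup.torsion U := by
    intro u
    rw [Submodule.mem_torsion_iff, CommGroup.mem_torsion, isOfFinOrder_iff_zpow_eq_one]
    constructor
    · rintro ⟨n, hn⟩
      exact ⟨n.1, nonZeroDivisors.ne_zero n.2, hn⟩
    · rintro ⟨n, hn, h⟩
      exact ⟨⟨n, by simpa using hn⟩, h⟩
  have hr : finrank ℤ (Additive U ⧸ T) = finrank ℤ (Additive U) :=
    finrank_quotient_eq_of_le_torsion le_rfl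
  let b := (Module.finBasisOfFinrankEq ℤ (Additive U ⧸ T) hr).equivFun
  obtain ⟨s, hs⟩ := Module.projective_lifting_property T.mkQ LinearMap.id T.mkQ_surjective
  have hs' : ∀ x, T.mkQ (s x) = x := fun x => LinearMap.congr_fun hs x
  let φ : Multiplicative (Fin (finrank ℤ (Additive U)) → ℤ) →* U :=
    AddMonoidHom.toMultiplicativeLeft ((s.comp b.symm.toLinearMap).toAddMonoidHom)
  have hφ : ∀ v, Additive.ofMul (φ v) = s (b.symm v.toAdd) := fun v => rfl
  have hinj : Function.Injective φ := by
    intro v w h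
    have h1 : s (b.symm v.toAdd) = s (b.symm w.toAdd) := by rw [← hφ, ← hφ, h]
    have h2 := congrArg T.mkQ h1
    rw [hs', hs'] at h2
    exact b.symm.injective h2
  refine ⟨φ.range, ⟨(MonoidHom.ofInjective hinj).symm⟩, ?_, ?_⟩
  · rw [eq_bot_iff]
    rintro u ⟨hu, v, rfl⟩
    have h1 : T.mkQ (Additive.ofMul (φ v)) = 0 := by
      rw [Submodule.mkQ_apply, Submodule.Quotient.mk_eq_zero]
      exact (hT _).2 hu
    rw [hφ, hs'] at h1
    have h2 : v.toAdd = 0 := by simpa using h1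
    have h3 : v = 1 := h2
    rw [h3, map_one]
    exact Subgroup.mem_bot.2 rfl
  · rw [eq_top_iff]
    intro u _
    let v := Multiplicative.ofAdd (b (T.mkQ (Additive.ofMul u)))
    have h1 : u * (φ v)⁻¹ ∈ CommGroup.torsion U := by
      rw [← hT, ← Submodule.Quotient.mk_eq_zero, ← Submodule.mkQ_apply, ofMul_mul, ofMul_inv,
        map_add, map_neg, hφ, hs']
      simp [v]
    have h2 : u = (u * (φ v)⁻¹) * φ v := by simp
    rw [h2]
    exact Subgroup.mul_mem_sup h1 ⟨v, rfl⟩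

theorem exists_int_multiple {G : Type*} [CommGroup G] (a : MonoidAlgebra ℚ G) :
    ∃ n : ℤ, n ≠ 0 ∧ ∃ x : MonoidAlgebra ℤ G,
      MonoidAlgebra.mapRingHom G (Int.castRingHom ℚ) x = n • a := by
  induction a using MonoidAlgebra.induction_linear with
  | zero => exact ⟨1, one_ne_zero, 0, by simp⟩
  | add a b ha hb =>
    obtain ⟨n, hn, x, hx⟩ := ha
    obtain ⟨m, hm, y, hy⟩ := hb
    refine ⟨n * m, mul_ne_zero hn hm, m • x + n • y, ?_⟩
    rw [map_add, map_zsmul, map_zsmul, hx, hy, smul_add, smul_smul, smul_smul, mul_comm m n]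
  | single g q =>
    refine ⟨q.den, by simp, MonoidAlgebra.single g q.num, ?_⟩
    rw [MonoidAlgebra.mapRingHom_single, MonoidAlgebra.smul_single]
    congr 1
    simp [Rat.den_mul_eq_num]

theorem unit_rank_group_ring (G : Type*) [CommGroup G] [Finite G] :
    Module.Finite ℤ (Additive (MonoidAlgebra ℤ G)ˣ) ∧
    2 * finrank ℤ (Additive (MonoidAlgebra ℤ G)ˣ) +
        2 * Nat.card {H : Subgroup G // IsCyclic H} =
      Nat.card G + 1 + Nat.card {g : G // orderOf g = 2} := by
  let A := MonoidAlgebra ℚ G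
  let _ : Fintype (MaximalSpectrum A) := Fintype.ofFinite _
  let K : MaximalSpectrum A → Type _ := fun m => A ⧸ m.asIdeal
  let _ : ∀ m, Field (K m) := fun m =>
    have := m.isMaximal
    Ideal.Quotient.field m.asIdeal
  have hchar : ∀ m, CharZero (K m) := fun m => algebraRat.charZero (A ⧸ m.asIdeal)
  have hnf : ∀ m, NumberField (K m) := by
    intro m
    refine { to_charZero := hchar m, to_finiteDimensional := ?_ }
    have h1 : Module.Finite ℚ (A ⧸ m.asIdeal) := inferInstance
    convert h1
    exact Subsingleton.elim _ _
  let e : A ≃+* ∀ m, K m := (IsArtinianRing.equivPi A).toRingEquiv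
  let f : MonoidAlgebra ℤ G →+* ∀ m, K m :=
    (e : A →+* ∀ m, K m).comp (MonoidAlgebra.mapRingHom G (Int.castRingHom ℚ))
  have hf : Function.Injective f := by
    apply e.injective.comp
    exact MonoidAlgebra.map_injective (Int.castRingHom ℚ).toAddMonoidHom Int.cast_injective
  obtain ⟨hfin, hrank⟩ := unit_rank_of_order K f hf (by
    intro y
    obtain ⟨n, hn, x, hx⟩ := exists_int_multiple (e.symm y)
    refine ⟨n, hn, x, ?_⟩
    change e (MonoidAlgebra.mapRingHom G (Int.castRingHom ℚ) x) = _
    rw [hx, map_zsmul, e.apply_symm_apply])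
  refine ⟨hfin, ?_⟩
  rw [hrank, ← card_maximalSpectrum]
  exact rank_count G K (fun m => Ideal.Quotient.mk m.asIdeal)
    (fun m => Ideal.Quotient.mk_surjective) (quotient_hom_bij A)

/-- **Lemma 5** (Artamonov–Bovdi).  For a finite abelian group `G`, the unit group
`U(ℤG)` is the internal direct product of the group `±G` of trivial units and a free
abelian subgroup `S_G` whose rank `r` satisfies `2r = |G| + 1 + t₂ − 2l`, where `t₂` is
the number of involutions of `G` and `l` the number of cyclic subgroups of `G`
(stated as `2r + 2l = |G| + 1 + t₂`). -/
theorem units_int_group_ring_decomposition (G : Type*) [CommGroup G] [Finite G] :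
    ∃ (S : Subgroup (MonoidAlgebra ℤ G)ˣ) (r : ℕ),
      Nonempty (S ≃* Multiplicative (Fin r → ℤ))
      ∧ trivialUnits G ⊓ S = ⊥
      ∧ trivialUnits G ⊔ S = ⊤
      ∧ 2 * r + 2 * Nat.card {H : Subgroup G // IsCyclic H}
          = Nat.card G + 1 + Nat.card {g : G // orderOf g = 2} := by
  obtain ⟨hfin, hrank⟩ := unit_rank_group_ring G
  obtain ⟨S, h1, h2, h3⟩ := exists_free_complement (MonoidAlgebra ℤ G)ˣ
  rw [trivialUnits_eq_torsion]
  exact ⟨S, _, h1, h2, h3, hrank⟩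
end

section
/- Let K be a commutative ring with unity, G a group, and H a subgroup of G. Let L be the left annihilator in KG of the right ideal of KG generated by the set {h − 1 : h ∈ H, h ≠ 1}. Then L ≠ {0} if and only if H is finite; and if H is finite, then L = KG·Ĥ, where Ĥ = ∑_{h ∈ H} h. -/
/-- Membership in the left annihilator means that the coefficients are constant on left cosets. -/
theorem mem_ann_iff_aux {K G : Type*} [CommRing K] [Group G] (H : Subgroup G)
    (x : MonoidAlgebra K G) :
    (∀ y ∈ Submodule.span (MonoidAlgebra K G)ᵐᵒᵖ
        {y : MonoidAlgebra K G | ∃ h : G, h ∈ H ∧ h ≠ 1 ∧ y = MonoidAlgebra.of K G h - 1},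
      x * y = 0) ↔ ∀ h ∈ H, ∀ g : G, x.coeff (g * h) = x.coeff g := by
  constructor
  · intro hx h hh g
    by_cases h1 : h = 1
    · simp [h1]
    have h2 := hx _ (Submodule.subset_span ⟨h, hh, h1, rfl⟩)
    rw [mul_sub, mul_one, sub_eq_zero] at h2
    have h3 := congrArg (fun z => z.coeff (g * h)) h2
    simpa [MonoidAlgebra.of_apply] using h3.symm
  · intro hx y hy
    induction hy using Submodule.span_induction with
    | mem y hy =>
      obtain ⟨h, hh, -, rfl⟩ := hy
      rw [mul_sub, mul_one, sub_eq_zero]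
      ext g
      have := hx h⁻¹ (H.inv_mem hh) g
      simpa [MonoidAlgebra.of_apply] using this
    | zero => simp
    | add a b _ _ ha hb => rw [mul_add, ha, hb, add_zero]
    | smul a b _ hb =>
      rw [← MulOpposite.op_unop a, op_smul_eq_mul, ← mul_assoc, hb, zero_mul]

theorem coeff_mul_hat_aux {K G : Type*} [CommRing K] [Group G] (z : MonoidAlgebra K G)
    (s : Finset G) (g : G) :
    (z * ∑ h ∈ s, MonoidAlgebra.of K G h).coeff g = ∑ h ∈ s, z.coeff (g * h⁻¹) := by
  rw [Finset.mul_sum]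
  simp [MonoidAlgebra.of_apply, Finsupp.finset_sum_apply]

theorem hat_inv_aux {K G : Type*} [CommRing K] [Group G] (H : Subgroup G)
    (hfin : (H : Set G).Finite) (z : MonoidAlgebra K G) :
    ∀ k ∈ H, ∀ g : G, (z * ∑ h ∈ hfin.toFinset, MonoidAlgebra.of K G h).coeff (g * k)
      = (z * ∑ h ∈ hfin.toFinset, MonoidAlgebra.of K G h).coeff g := by
  intro k hk g
  rw [coeff_mul_hat_aux, coeff_mul_hat_aux]
  refine Finset.sum_bij' (fun h _ => h * k⁻¹) (fun h _ => h * k) ?_ ?_ ?_ ?_ ?_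
  · intro h hh
    simp only [Set.Finite.mem_toFinset, SetLike.mem_coe] at hh ⊢
    exact H.mul_mem hh (H.inv_mem hk)
  · intro h hh
    simp only [Set.Finite.mem_toFinset, SetLike.mem_coe] at hh ⊢
    exact H.mul_mem hh hk
  · simp
  · simp
  · intro h _
    simp [mul_assoc]

theorem exists_hat_aux {K G : Type*} [CommRing K] [Group G] (H : Subgroup G)
    (hfin : (H : Set G).Finite) (x : MonoidAlgebra K G)
    (hx : ∀ h ∈ H, ∀ g : G, x.coeff (g * h) = x.coeff g) :
    ∃ z : MonoidAlgebra K G, x = z * ∑ h ∈ hfin.toFinset, MonoidAlgebra.of K G h := by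
  classical
  let rep : G → G := fun g => (QuotientGroup.mk g : G ⧸ H).out
  have hrep : ∀ g, g⁻¹ * rep g ∈ H := fun g =>
    QuotientGroup.eq.1 (QuotientGroup.out_eq' (QuotientGroup.mk g : G ⧸ H)).symm
  have hrep2 : ∀ g, ∀ h ∈ H, rep (g * h) = rep g := by
    intro g h hh
    have : (QuotientGroup.mk (g * h) : G ⧸ H) = QuotientGroup.mk g :=
      (QuotientGroup.eq.2 (by simpa using hh)).symm
    simp only [rep, this]
  refine ⟨MonoidAlgebra.ofCoeff (x.coeff.filter (fun g => rep g = g)), ?_⟩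
  ext g
  rw [coeff_mul_hat_aux]
  rw [Finset.sum_eq_single ((rep g)⁻¹ * g)]
  · have h1 : g * ((rep g)⁻¹ * g)⁻¹ = g * (g⁻¹ * rep g) := by group
    rw [h1, MonoidAlgebra.coeff_ofCoeff, Finsupp.filter_apply_pos, hx _ (hrep g)]
    rw [hrep2 _ _ (hrep g)]
    group
  · intro h hh hne
    simp only [Set.Finite.mem_toFinset, SetLike.mem_coe] at hh
    rw [MonoidAlgebra.coeff_ofCoeff, Finsupp.filter_apply_neg]
    rw [hrep2 _ _ (H.inv_mem hh)]
    intro h2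
    apply hne
    rw [h2]
    group
  · intro hn
    exfalso
    apply hn
    simp only [Set.Finite.mem_toFinset, SetLike.mem_coe]
    have := H.inv_mem (hrep g)
    simpa using this

/-- **Lemma 7** (Bovdi).  Let `H` be a subgroup of `G` and let `L` be the left
annihilator in `KG` of the right ideal generated by `{h − 1 : h ∈ H, h ≠ 1}`
(a right ideal of `KG` is a submodule for the `(KG)ᵐᵒᵖ`-action).  Then `L ≠ 0`
iff `H` is finite, and if `H` is finite then `L = KG·Ĥ` where `Ĥ = ∑_{h ∈ H} h`. -/
theorem left_annihilator_augmentation_ideal {K G : Type*} [CommRing K] [Nontrivial K]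
    [Group G] (H : Subgroup G)
    (L : Set (MonoidAlgebra K G))
    (hL : L = {x : MonoidAlgebra K G |
      ∀ y ∈ Submodule.span (MonoidAlgebra K G)ᵐᵒᵖ
        {y : MonoidAlgebra K G | ∃ h : G, h ∈ H ∧ h ≠ 1 ∧ y = MonoidAlgebra.of K G h - 1},
      x * y = 0}) :
    (L ≠ {0} ↔ (H : Set G).Finite)
    ∧ ∀ hfin : (H : Set G).Finite,
        L = {x : MonoidAlgebra K G | ∃ z : MonoidAlgebra K G,
          x = z * ∑ h ∈ hfin.toFinset, MonoidAlgebra.of K G h} := by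
  have hL2 : ∀ x, x ∈ L ↔ ∀ h ∈ H, ∀ g : G, x.coeff (g * h) = x.coeff g := by
    intro x
    rw [hL]
    exact mem_ann_iff_aux H x
  refine ⟨⟨?_, ?_⟩, ?_⟩
  · intro hne
    have h0 : (0 : MonoidAlgebra K G) ∈ L := by
      rw [hL2]
      simp
    obtain ⟨x, hx, hx0⟩ : ∃ x ∈ L, x ≠ 0 := by
      by_contra! hcon
      exact hne (Set.eq_singleton_iff_unique_mem.2 ⟨h0, hcon⟩)
    rw [hL2] at hx
    obtain ⟨g, hg⟩ : ∃ g, x.coeff g ≠ 0 := by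
      by_contra! hcon
      apply hx0
      ext g
      simpa using hcon g
    refine Set.Finite.of_finite_image (f := fun h => g * h)
      (x.coeff.support.finite_toSet.subset ?_) (mul_right_injective g).injOn
    rintro _ ⟨h, hh, rfl⟩
    simpa [hx h hh g] using hg
  · intro hfin hL0
    have h1 : (1 * ∑ h ∈ hfin.toFinset, MonoidAlgebra.of K G h) ∈ L := by
      rw [hL2]
      exact hat_inv_aux H hfin 1
    rw [hL0, Set.mem_singleton_iff] at h1
    have h2 := congrArg (fun z => z.coeff 1) h1
    simp only [coeff_mul_hat_aux] at h2
    rw [Finset.sum_eq_single 1] at h2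
    · simp [MonoidAlgebra.one_def] at h2
    · intro h _ hne
      simp [MonoidAlgebra.one_def, Finsupp.single_apply, hne, eq_comm]
    · intro hn
      exact absurd (by simp [H.one_mem]) hn
  · intro hfin
    ext x
    rw [hL2]
    constructor
    · exact exists_hat_aux H hfin x
    · rintro ⟨z, rfl⟩
      exact hat_inv_aux H hfin z
end

section
/- Let Q₁₆ = ⟨a, b | a⁸ = 1, b² = a⁴, b⁻¹ab = a⁻¹⟩ be the generalized quaternion group of order 16, and work in the integral group ring ℤQ₁₆. Let b̂ = 1 + b + b² + b³ (the sum of the elements of ⟨b⟩), and set w₁ = 1 + (a⁻¹ − a)b̂ and w₂ = 6(a + a³)(1 − a⁴) + 9a² − 8a⁶. Then w₁ and w₂ are commuting units of ℤQ₁₆, with w₁⁻¹ = 1 − (a⁻¹ − a)b̂ and w₂⁻¹ = 6(a + a³)(1 − a⁴) + 9a⁶ − 8a², both w₁ and w₂ have infinite order, and w₁ⁿ = w₂ᵐ for integers n, m implies n = m = 0; consequently ⟨w₁, w₂⟩ is a free abelian subgroup of rank 2 (isomorphic to ℤ × ℤ) of U(ℤQ₁₆). -/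
/-- Relations of the generalized quaternion group
`Q₁₆ = ⟨a, b ∣ a⁸ = 1, b² = a⁴, b⁻¹ab = a⁻¹⟩`. -/
def q16Rels : Set (FreeGroup (Fin 2)) :=
  {FreeGroup.of 0 ^ 8, FreeGroup.of 1 ^ 2 * (FreeGroup.of 0 ^ 4)⁻¹,
    (FreeGroup.of 1)⁻¹ * FreeGroup.of 0 * FreeGroup.of 1 * FreeGroup.of 0}

/-- The generalized quaternion group `Q₁₆ = ⟨a, b ∣ a⁸ = 1, b² = a⁴, b⁻¹ab = a⁻¹⟩`. -/
abbrev Q16 := PresentedGroup q16Rels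

/-- The generator `a` of `Q₁₆`. -/
def q16a : Q16 := PresentedGroup.of 0

/-- The generator `b` of `Q₁₆`. -/
def q16b : Q16 := PresentedGroup.of 1

/-- `b̂ = 1 + b + b² + b³ ∈ ℤQ₁₆`, the sum of the elements of `⟨b⟩`. -/
noncomputable def q16bhat : MonoidAlgebra ℤ Q16 :=
  1 + MonoidAlgebra.of ℤ Q16 q16b + MonoidAlgebra.of ℤ Q16 (q16b ^ 2)
    + MonoidAlgebra.of ℤ Q16 (q16b ^ 3)

/-- `w₁ = 1 + (a⁻¹ − a)b̂ ∈ ℤQ₁₆`. -/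
noncomputable def q16w₁ : MonoidAlgebra ℤ Q16 :=
  1 + (MonoidAlgebra.of ℤ Q16 q16a⁻¹ - MonoidAlgebra.of ℤ Q16 q16a) * q16bhat

/-- `w₂ = 6(a + a³)(1 − a⁴) + 9a² − 8a⁶ ∈ ℤQ₁₆`. -/
noncomputable def q16w₂ : MonoidAlgebra ℤ Q16 :=
  6 * (MonoidAlgebra.of ℤ Q16 q16a + MonoidAlgebra.of ℤ Q16 (q16a ^ 3))
      * (1 - MonoidAlgebra.of ℤ Q16 (q16a ^ 4))
    + 9 * MonoidAlgebra.of ℤ Q16 (q16a ^ 2) - 8 * MonoidAlgebra.of ℤ Q16 (q16a ^ 6)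

section aux
variable {R : Type*} [Ring R] {A B : R}

theorem q16_xsq (h8 : A ^ 8 = 1) (hB : B ^ 2 = A ^ 4) (hBA : B * A = A ^ 7 * B) :
    ((A ^ 7 - A) * (1 + B + B ^ 2 + B ^ 3)) * ((A ^ 7 - A) * (1 + B + B ^ 2 + B ^ 3)) = 0 := by
  have hB4 : B ^ 4 = 1 := by
    rw [show 4 = 2 * 2 from rfl, pow_mul, hB, ← pow_mul, h8]
  have hk : ∀ k : ℕ, B * A ^ k = A ^ (7 * k) * B := by
    intro k
    induction k with
    | zero => simp
    | succ k ih =>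
      rw [pow_succ, ← mul_assoc, ih, mul_assoc, hBA, ← mul_assoc, ← pow_add, mul_add, mul_one]
  have h49 : A ^ 49 = A := by
    rw [show 49 = 8 * 6 + 1 from rfl, pow_add, pow_mul, h8]; simp
  have hBD : B * (A ^ 7 - A) = (A ^ 7 - A) * (-B) := by
    rw [mul_sub, hk, hBA, h49]; noncomm_ring
  generalize A ^ 7 - A = D at *
  have h2 : B ^ 2 * D = D * B ^ 2 := by
    rw [pow_two, mul_assoc, hBD, ← mul_assoc, hBD]; noncomm_ring
  have h3 : B ^ 3 * D = D * (- B ^ 3) := by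
    rw [pow_succ, mul_assoc, hBD, ← mul_assoc, h2]; noncomm_ring
  have e : (1 + B + B ^ 2 + B ^ 3) * D = D * (1 - B + B ^ 2 - B ^ 3) := by
    rw [add_mul, add_mul, add_mul, hBD, h2, h3]; noncomm_ring
  have e2 : (1 - B + B ^ 2 - B ^ 3) * (1 + B + B ^ 2 + B ^ 3) = 0 := by
    have : (1 - B + B ^ 2 - B ^ 3) * (1 + B + B ^ 2 + B ^ 3) = (1 + B ^ 2) * (1 - B ^ 4) := by
      noncomm_ring
    rw [this, hB4]; simp
  rw [mul_assoc, ← mul_assoc _ D, e, mul_assoc D, e2]; simp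

theorem q16_comm (h8 : A ^ 8 = 1) (hB : B ^ 2 = A ^ 4) (hBA : B * A = A ^ 7 * B) :
    Commute ((A ^ 7 - A) * (1 + B + B ^ 2 + B ^ 3))
      (6 * (A + A ^ 3) * (1 - A ^ 4) + 9 * A ^ 2 - 8 * A ^ 6) := by
  have hB4 : B ^ 4 = 1 := by
    rw [show 4 = 2 * 2 from rfl, pow_mul, hB, ← pow_mul, h8]
  have hA2 : B * A ^ 2 = A ^ 2 * B ^ 3 := by
    have h14 : A ^ 14 = A ^ 2 * A ^ 4 := by
      rw [show 14 = 8 + 6 from rfl, pow_add, h8, one_mul, ← pow_add]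
    have : A ^ 7 * A ^ 7 = A ^ 2 * B ^ 2 := by rw [← pow_add, h14, hB]
    rw [pow_two, ← mul_assoc, hBA, mul_assoc, hBA, ← mul_assoc, this, pow_succ B 2]; noncomm_ring
  have hB2 : B ^ 2 * A ^ 2 = A ^ 2 * B ^ 2 := by rw [hB, ← pow_add, ← pow_add]
  have hB3 : B ^ 3 * A ^ 2 = A ^ 2 * B := by
    rw [pow_succ, mul_assoc, hA2, ← mul_assoc, hB2, mul_assoc, ← pow_add,
      show 2 + 3 = 4 + 1 from rfl, pow_add, hB4]; simp
  set b := 1 + B + B ^ 2 + B ^ 3 with hb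
  have hbA : b * A ^ 2 = A ^ 2 * b := by
    rw [hb, add_mul, add_mul, add_mul, hA2, hB2, hB3]; noncomm_ring
  have z1 : b * (1 - A ^ 4) = 0 := by
    have : b * (1 - B ^ 2) = (1 + B) * (1 - B ^ 4) := by rw [hb]; noncomm_ring
    rw [← hB, this, hB4]; simp
  have z2 : (1 - A ^ 4) * b = 0 := by
    have : (1 - B ^ 2) * b = (1 + B) * (1 - B ^ 4) := by rw [hb]; noncomm_ring
    rw [← hB, this, hB4]; simp
  have w : (6 * (A + A ^ 3) * (1 - A ^ 4) + 9 * A ^ 2 - 8 * A ^ 6)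
      = A ^ 2 + (6 * (A + A ^ 3) + 8 * A ^ 2) * (1 - A ^ 4) := by noncomm_ring
  have w' : (6 * (A + A ^ 3) + 8 * A ^ 2) * (1 - A ^ 4)
      = (1 - A ^ 4) * (6 * (A + A ^ 3) + 8 * A ^ 2) := by noncomm_ring
  have hD : (A ^ 7 - A) * A ^ 2 = A ^ 2 * (A ^ 7 - A) := by noncomm_ring
  have hD4 : (1 - A ^ 4) * (A ^ 7 - A) = (A ^ 7 - A) * (1 - A ^ 4) := by noncomm_ring
  rw [w]
  apply Commute.add_right
  · change _ * _ = _ * _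
    rw [mul_assoc, hbA, ← mul_assoc, hD, mul_assoc]
  · change _ * _ = _ * _
    have l : (A ^ 7 - A) * b * ((6 * (A + A ^ 3) + 8 * A ^ 2) * (1 - A ^ 4)) = 0 := by
      rw [w', mul_assoc, ← mul_assoc b, z1]; simp
    rw [l, mul_assoc, ← mul_assoc (1 - A ^ 4), hD4, mul_assoc _ _ b, z2]; simp

theorem q16_inv (h8 : A ^ 8 = 1) :
    (6 * (A + A ^ 3) * (1 - A ^ 4) + 9 * A ^ 2 - 8 * A ^ 6) *
    (6 * (A + A ^ 3) * (1 - A ^ 4) + 9 * A ^ 6 - 8 * A ^ 2) = 1 := by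
  have h : (6 * (A + A ^ 3) * (1 - A ^ 4) + 9 * A ^ 2 - 8 * A ^ 6) *
    (6 * (A + A ^ 3) * (1 - A ^ 4) + 9 * A ^ 6 - 8 * A ^ 2) =
      1 + (A ^ 8 - 1) * (1 + 36 * A ^ 6 - 36 * A ^ 2 - 6 * A ^ 3 - 6 * A ^ 5) := by noncomm_ring
  rw [h, h8]; simp

theorem q16_inv2 (h8 : A ^ 8 = 1) :
    (6 * (A + A ^ 3) * (1 - A ^ 4) + 9 * A ^ 6 - 8 * A ^ 2) *
    (6 * (A + A ^ 3) * (1 - A ^ 4) + 9 * A ^ 2 - 8 * A ^ 6) = 1 := by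
  have : (6 * (A + A ^ 3) * (1 - A ^ 4) + 9 * A ^ 6 - 8 * A ^ 2) *
    (6 * (A + A ^ 3) * (1 - A ^ 4) + 9 * A ^ 2 - 8 * A ^ 6) =
    (6 * (A + A ^ 3) * (1 - A ^ 4) + 9 * A ^ 2 - 8 * A ^ 6) *
    (6 * (A + A ^ 3) * (1 - A ^ 4) + 9 * A ^ 6 - 8 * A ^ 2) := by noncomm_ring
  rw [this, q16_inv h8]

end aux

theorem q16_r8 : q16a ^ 8 = 1 :=
  PresentedGroup.one_of_mem (rels := q16Rels) (x := FreeGroup.of 0 ^ 8) (by simp [q16Rels])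

theorem q16_rB : q16b ^ 2 = q16a ^ 4 := by
  have : q16b ^ 2 * (q16a ^ 4)⁻¹ = 1 :=
    PresentedGroup.one_of_mem (rels := q16Rels)
      (x := FreeGroup.of 1 ^ 2 * (FreeGroup.of 0 ^ 4)⁻¹) (by simp [q16Rels])
  exact mul_inv_eq_one.mp this

theorem q16_ainv : q16a⁻¹ = q16a ^ 7 :=
  inv_eq_of_mul_eq_one_right (by rw [← pow_succ']; exact q16_r8)

theorem q16_rBA : q16b * q16a = q16a ^ 7 * q16b := by
  have h : q16b⁻¹ * q16a * q16b * q16a = 1 :=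
    PresentedGroup.one_of_mem (rels := q16Rels)
      (x := (FreeGroup.of 1)⁻¹ * FreeGroup.of 0 * FreeGroup.of 1 * FreeGroup.of 0)
      (by simp [q16Rels])
  rw [← q16_ainv, eq_inv_mul_iff_mul_eq]
  have : q16a * (q16b * q16a) = q16b * (q16b⁻¹ * q16a * q16b * q16a) := by group
  rw [this, h, mul_one]

noncomputable def q16A : MonoidAlgebra ℤ Q16 := MonoidAlgebra.of ℤ Q16 q16a
noncomputable def q16B : MonoidAlgebra ℤ Q16 := MonoidAlgebra.of ℤ Q16 q16b
noncomputable def q16x : MonoidAlgebra ℤ Q16 :=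
  (q16A ^ 7 - q16A) * (1 + q16B + q16B ^ 2 + q16B ^ 3)

theorem q16_A8 : q16A ^ 8 = 1 := by
  rw [q16A, ← map_pow, q16_r8, map_one]
theorem q16_B2 : q16B ^ 2 = q16A ^ 4 := by
  rw [q16A, q16B, ← map_pow, q16_rB, map_pow]
theorem q16_BA : q16B * q16A = q16A ^ 7 * q16B := by
  rw [q16A, q16B, ← map_mul, q16_rBA, map_mul, map_pow]

theorem q16x_eq : (MonoidAlgebra.of ℤ Q16 q16a⁻¹ - MonoidAlgebra.of ℤ Q16 q16a) * q16bhat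
    = q16x := by
  rw [q16x, q16bhat, q16_ainv]; simp only [map_pow]; rfl

theorem q16w₁_eq : q16w₁ = 1 + q16x := by rw [q16w₁, q16x_eq]

theorem q16w₂_eq : q16w₂ =
    6 * (q16A + q16A ^ 3) * (1 - q16A ^ 4) + 9 * q16A ^ 2 - 8 * q16A ^ 6 := by
  rw [q16w₂]; simp only [map_pow]; rfl

theorem q16x_sq : q16x * q16x = 0 := q16_xsq q16_A8 q16_B2 q16_BA

theorem q16_comm_w : q16w₁ * q16w₂ = q16w₂ * q16w₁ := by
  rw [q16w₁_eq, q16w₂_eq]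
  exact ((Commute.one_left _).add_left (q16_comm q16_A8 q16_B2 q16_BA))

/-- lifting of representations -/
theorem q16_rep {S : Type*} [Ring S] (a b : Sˣ) (h8 : a ^ 8 = 1) (hB : b ^ 2 = a ^ 4)
    (hBA : b⁻¹ * a * b * a = 1) :
    ∃ f : MonoidAlgebra ℤ Q16 →+* S, f q16A = a ∧ f q16B = b := by
  let g : Q16 →* Sˣ := PresentedGroup.toGroup (rels := q16Rels) (f := ![a, b]) (by
    intro r hr
    rcases hr with rfl | rfl | rfl
    · simpa using h8
    · simp [hB]
    · simpa using hBA)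
  refine ⟨(MonoidAlgebra.lift ℤ S Q16 ((Units.coeHom S).comp g)).toRingHom, ?_, ?_⟩
  · simp [q16A, q16a, g]
  · simp [q16B, q16b, g]

theorem q16_repD : ∃ f : MonoidAlgebra ℤ Q16 →+* Matrix (Fin 2) (Fin 2) ℤ,
    f q16x = !![0, 0; -8, 0] := by
  obtain ⟨f, ha, hb⟩ := q16_rep (S := Matrix (Fin 2) (Fin 2) ℤ)
    ⟨!![0, -1; 1, 0], !![0, 1; -1, 0], by decide, by decide⟩
    ⟨!![1, 0; 0, -1], !![1, 0; 0, -1], by decide, by decide⟩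
    (by ext1; decide) (by ext1; decide) (by ext1; decide)
  refine ⟨f, ?_⟩
  rw [q16x]
  simp only [map_mul, map_sub, map_add, map_pow, map_one, ha, hb]
  decide

/-- The quaternion with the given coordinates. -/
noncomputable def q16q (a b c d : ℝ) : Quaternion ℝ := ⟨a, b, c, d⟩

theorem q16_qmul (a b c d a' b' c' d' : ℝ) : q16q a b c d * q16q a' b' c' d' =
    q16q (a * a' - b * b' - c * c' - d * d') (a * b' + b * a' + c * d' - d * c')
      (a * c' - b * d' + c * a' + d * b') (a * d' + b * c' - c * b' + d * a') := by
  refine (QuaternionAlgebra.mk_mul_mk ..).trans ?_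
  unfold q16q
  congr 1 <;> ring

theorem q16_qadd (a b c d a' b' c' d' : ℝ) : q16q a b c d + q16q a' b' c' d' =
    q16q (a + a') (b + b') (c + c') (d + d') := rfl

theorem q16_qsmul (r a b c d : ℝ) : r • q16q a b c d =
    q16q (r * a) (r * b) (r * c) (r * d) := rfl

theorem q16_qone : (1 : Quaternion ℝ) = q16q 1 0 0 0 := rfl
theorem q16_qneg : (-1 : Quaternion ℝ) = q16q (-1) 0 0 0 := by
  have h : (-1 : Quaternion ℝ) = q16q (-1) (-0) (-0) (-0) := rfl
  rw [h, neg_zero]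

theorem q16_qext {a b c d a' b' c' d' : ℝ} (h1 : a = a') (h2 : b = b') (h3 : c = c')
    (h4 : d = d') : q16q a b c d = q16q a' b' c' d' := by
  rw [h1, h2, h3, h4]

theorem q16_qnorm (r : ℝ) (hr : 0 ≤ r) : ‖q16q 0 r 0 0‖ = r := by
  have hn := Quaternion.normSq_eq_norm_mul_self (q16q 0 r 0 0)
  have h : Quaternion.normSq (q16q 0 r 0 0) = 0 ^ 2 + r ^ 2 + 0 ^ 2 + 0 ^ 2 :=
    Quaternion.normSq_def' _
  refine (mul_self_inj (norm_nonneg _) hr).mp ?_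
  rw [← hn, h]; ring

theorem q16_repH : ∃ f : MonoidAlgebra ℤ Q16 →+* Quaternion ℝ,
    f q16x = 0 ∧ ‖f q16w₂‖ = 17 + 12 * √2 := by
  have s2 : √2 * √2 = (2 : ℝ) := by norm_num
  let a : Quaternion ℝ := q16q (√2 / 2) (√2 / 2) 0 0
  let a' : Quaternion ℝ := q16q (√2 / 2) (-(√2 / 2)) 0 0
  let b : Quaternion ℝ := q16q 0 0 1 0
  let b' : Quaternion ℝ := q16q 0 0 (-1) 0
  have aa' : a * a' = 1 := by
    simp only [a, a', q16_qmul, q16_qone]; apply q16_qext <;> grind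
  have a'a : a' * a = 1 := by
    simp only [a, a', q16_qmul, q16_qone]; apply q16_qext <;> grind
  have bb' : b * b' = 1 := by
    simp only [b, b', q16_qmul, q16_qone]; apply q16_qext <;> grind
  have b'b : b' * b = 1 := by
    simp only [b, b', q16_qmul, q16_qone]; apply q16_qext <;> grind
  have ha2 : a ^ 2 = q16q 0 1 0 0 := by
    rw [pow_two]; simp only [a, q16_qmul]; apply q16_qext <;> grind
  have ha4 : a ^ 4 = -1 := by
    rw [show 4 = 2 * 2 from rfl, pow_mul, ha2, pow_two, q16_qneg, q16_qmul]
    apply q16_qext <;> grind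
  have hb2 : b ^ 2 = -1 := by
    rw [pow_two, q16_qneg]; simp only [b, q16_qmul]; apply q16_qext <;> grind
  have h3 : b' * a * b * a = 1 := by
    simp only [a, b, b', q16_qmul, q16_qone]; apply q16_qext <;> grind
  obtain ⟨f, ha, hb⟩ := q16_rep (S := Quaternion ℝ) ⟨a, a', aa', a'a⟩ ⟨b, b', bb', b'b⟩
    (by ext1; change a ^ 8 = 1; rw [show 8 = 4 * 2 from rfl, pow_mul, ha4]; simp)
    (by ext1; change b ^ 2 = a ^ 4; rw [ha4, hb2])
    (by ext1; exact h3)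
  change _ = a at ha
  change _ = b at hb
  refine ⟨f, ?_, ?_⟩
  · rw [q16x]
    simp only [map_mul, map_sub, map_add, map_pow, map_one, ha, hb, pow_succ b 2, hb2]
    simp
  · have : f q16w₂ = q16q 0 (17 + 12 * √2) 0 0 := by
      rw [q16w₂_eq]
      simp only [map_mul, map_sub, map_add, map_pow, map_one, map_ofNat, ha]
      have e : (6 * (a + a ^ 3) * (1 - a ^ 4) + 9 * a ^ 2 - 8 * a ^ 6)
        = (12 : ℝ) • (a + a ^ 2 * a) + (17 : ℝ) • a ^ 2 := by
        rw [show a ^ 6 = a ^ 4 * a ^ 2 from pow_add a 4 2, ha4, pow_succ a 2]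
        have h12 : (12 : ℝ) • (a + a ^ 2 * a) = 12 * (a + a ^ 2 * a) := by
          rw [← Quaternion.coe_mul_eq_smul]; rfl
        have h17 : (17 : ℝ) • a ^ 2 = 17 * a ^ 2 := by
          rw [← Quaternion.coe_mul_eq_smul]; rfl
        rw [h12, h17]
        noncomm_ring
      rw [e, ha2]
      simp only [a, q16_qmul, q16_qadd, q16_qsmul]
      apply q16_qext <;> ring
    rw [this]
    exact q16_qnorm _ (by positivity)

theorem q16_l1 : (1 + q16x) * (1 - q16x) = 1 := by
  rw [mul_sub, add_mul, add_mul, q16x_sq, mul_one, mul_one, one_mul]; abel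

theorem q16_l2 : (1 - q16x) * (1 + q16x) = 1 := by
  rw [mul_add, sub_mul, sub_mul, q16x_sq, mul_one, mul_one, one_mul]; abel

theorem q16_upow (u : (MonoidAlgebra ℤ Q16)ˣ) (hu : (u : MonoidAlgebra ℤ Q16) = q16w₁) (n : ℤ) :
    ((u ^ n : (MonoidAlgebra ℤ Q16)ˣ) : MonoidAlgebra ℤ Q16) = 1 + n • q16x := by
  rw [q16w₁_eq] at hu
  have hi : ((u⁻¹ : (MonoidAlgebra ℤ Q16)ˣ) : MonoidAlgebra ℤ Q16) = 1 - q16x := by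
    have h : (u : MonoidAlgebra ℤ Q16) * (1 - q16x) = 1 := by rw [hu, q16_l1]
    exact Units.inv_eq_of_mul_eq_one_right h
  induction n with
  | zero => simp
  | succ n ih =>
    rw [zpow_add_one, Units.val_mul, ih, hu, mul_add, add_mul, add_mul, smul_mul_assoc,
      smul_mul_assoc, q16x_sq, add_smul, smul_zero, mul_one, mul_one, one_mul, one_smul]
    abel
  | pred n ih =>
    rw [zpow_sub_one, Units.val_mul, ih, hi, mul_sub, add_mul, add_mul, smul_mul_assoc,
      smul_mul_assoc, q16x_sq, sub_smul, smul_zero, mul_one, mul_one, one_mul, one_smul]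
    abel

theorem q16_indep (u v : (MonoidAlgebra ℤ Q16)ˣ) (hu : (u : MonoidAlgebra ℤ Q16) = q16w₁)
    (hv : (v : MonoidAlgebra ℤ Q16) = q16w₂) (n m : ℤ) (h : u ^ n = v ^ m) : n = 0 ∧ m = 0 := by
  have hm : m = 0 := by
    obtain ⟨f, hx, hw⟩ := q16_repH
    have h1 := congrArg (fun t => ‖((Units.map (f : _ →* Quaternion ℝ) t : (Quaternion ℝ)ˣ) :
      Quaternion ℝ)‖) h
    simp only [map_zpow (Units.map (f : _ →* Quaternion ℝ)) v, Units.val_zpow_eq_zpow_val,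
      norm_zpow] at h1
    simp only [Units.coe_map, MonoidHom.coe_coe, hv, hw, q16_upow u hu, map_add, map_one,
      map_zsmul, hx, smul_zero, add_zero, norm_one] at h1
    have : (0 : ℝ) ≤ √2 := by positivity
    have hgt : (1 : ℝ) < 17 + 12 * √2 := by linarith
    exact ((zpow_right_injective₀ (by linarith) hgt.ne') (by simpa using h1)).symm
  subst hm
  refine ⟨?_, rfl⟩
  obtain ⟨f, hx⟩ := q16_repD
  have h1 := q16_upow u hu n
  rw [h, zpow_zero, Units.val_one, left_eq_add] at h1
  have h2 := congrArg (fun t => f t 1 0) h1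
  simp only [map_zsmul, hx, map_zero, Matrix.smul_apply, Matrix.zero_apply] at h2
  simpa using h2

theorem q16_free {G : Type*} [Group G] (u v : G) (hc : Commute u v)
    (hi : ∀ n m : ℤ, u ^ n = v ^ m → n = 0 ∧ m = 0) :
    Nonempty ((Subgroup.closure {u, v} : Subgroup G) ≃* Multiplicative (ℤ × ℤ)) := by
  let φ : Multiplicative (ℤ × ℤ) →* G :=
    { toFun := fun p => u ^ p.toAdd.1 * v ^ p.toAdd.2
      map_one' := by simp
      map_mul' := by
        intro p q
        simp only [toAdd_mul, Prod.fst_add, Prod.snd_add, zpow_add]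
        rw [mul_assoc, mul_assoc, ← mul_assoc (u ^ q.toAdd.1),
          ((hc.zpow_zpow q.toAdd.1 p.toAdd.2).eq), mul_assoc] }
  have hφ : Function.Injective φ := by
    rw [injective_iff_map_eq_one]
    intro p hp
    change u ^ p.toAdd.1 * v ^ p.toAdd.2 = 1 at hp
    have := hi p.toAdd.1 (-p.toAdd.2) (by rw [zpow_neg]; exact eq_inv_of_mul_eq_one_left hp)
    apply Multiplicative.toAdd.injective
    ext
    · exact this.1
    · exact neg_eq_zero.mp this.2
  have hr : φ.range = Subgroup.closure {u, v} := by
    apply le_antisymm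
    · rintro _ ⟨p, rfl⟩
      exact mul_mem (zpow_mem (Subgroup.subset_closure (by simp)) _)
        (zpow_mem (Subgroup.subset_closure (by simp)) _)
    · rw [Subgroup.closure_le]
      rintro _ (rfl | rfl)
      · exact ⟨Multiplicative.ofAdd (1, 0), by simp [φ]⟩
      · exact ⟨Multiplicative.ofAdd (0, 1), by simp [φ]⟩
  exact ⟨((MonoidHom.ofInjective hφ).trans (MulEquiv.subgroupCongr hr)).symm⟩

/-- In `ℤQ₁₆`, the elements `w₁ = 1 + (a⁻¹ − a)b̂` and `w₂ = 6(a + a³)(1 − a⁴) + 9a² − 8a⁶`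
are commuting units with the indicated inverses, both of infinite order, satisfying no
relation `w₁ⁿ = w₂ᵐ` except `n = m = 0`; hence `⟨w₁, w₂⟩` is a free abelian subgroup of
rank 2 (isomorphic to `ℤ × ℤ`) of `U(ℤQ₁₆)`. -/
theorem q16_units_generate_Z2 :
    q16w₁ * q16w₂ = q16w₂ * q16w₁
    ∧ (∃ u : (MonoidAlgebra ℤ Q16)ˣ, (u : MonoidAlgebra ℤ Q16) = q16w₁
        ∧ ((u⁻¹ : (MonoidAlgebra ℤ Q16)ˣ) : MonoidAlgebra ℤ Q16)
            = 1 - (MonoidAlgebra.of ℤ Q16 q16a⁻¹ - MonoidAlgebra.of ℤ Q16 q16a) * q16bhat)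
    ∧ (∃ v : (MonoidAlgebra ℤ Q16)ˣ, (v : MonoidAlgebra ℤ Q16) = q16w₂
        ∧ ((v⁻¹ : (MonoidAlgebra ℤ Q16)ˣ) : MonoidAlgebra ℤ Q16)
            = 6 * (MonoidAlgebra.of ℤ Q16 q16a + MonoidAlgebra.of ℤ Q16 (q16a ^ 3))
                * (1 - MonoidAlgebra.of ℤ Q16 (q16a ^ 4))
              + 9 * MonoidAlgebra.of ℤ Q16 (q16a ^ 6)
              - 8 * MonoidAlgebra.of ℤ Q16 (q16a ^ 2))
    ∧ (∀ u v : (MonoidAlgebra ℤ Q16)ˣ,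
        (u : MonoidAlgebra ℤ Q16) = q16w₁ → (v : MonoidAlgebra ℤ Q16) = q16w₂ →
        ¬ IsOfFinOrder u ∧ ¬ IsOfFinOrder v ∧ Commute u v
        ∧ (∀ n m : ℤ, u ^ n = v ^ m → n = 0 ∧ m = 0)
        ∧ Nonempty ((Subgroup.closure {u, v} : Subgroup (MonoidAlgebra ℤ Q16)ˣ)
            ≃* Multiplicative (ℤ × ℤ))) := by
  refine ⟨q16_comm_w, ?_, ?_, ?_⟩
  · rw [q16x_eq, q16w₁_eq]
    exact ⟨⟨1 + q16x, 1 - q16x, q16_l1, q16_l2⟩, rfl, rfl⟩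
  · rw [q16w₂_eq]
    simp only [map_pow]
    exact ⟨⟨_, _, q16_inv q16_A8, q16_inv2 q16_A8⟩, rfl, rfl⟩
  · intro u v hu hv
    have hc : Commute u v := by
      apply Units.ext
      rw [Units.val_mul, Units.val_mul, hu, hv, q16_comm_w]
    have hi := q16_indep u v hu hv
    refine ⟨?_, ?_, hc, hi, q16_free u v hc hi⟩
    · rw [isOfFinOrder_iff_pow_eq_one]
      rintro ⟨n, hn, h⟩
      have := (hi n 0 (by simpa using h)).1
      omega
    · rw [isOfFinOrder_iff_pow_eq_one]
      rintro ⟨n, hn, h⟩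
      have := (hi 0 n (by simpa using h.symm)).2
      omega
end

section
/- Let H_{3,8} = ⟨a, b | a³ = b⁸ = 1, b⁻¹ab = a⁻¹⟩ and work in the integral group ring ℤH_{3,8}. Let b̂ = ∑_{i=1}^{8} bⁱ (the sum of the elements of ⟨b⟩), and set w₁ = 1 + (a⁻¹ − a)b̂ and w₂ = 6(b + b³)(1 − b⁴) + 9b² − 8b⁶. Then w₁ and w₂ are commuting units of ℤH_{3,8}, with w₁⁻¹ = 1 − (a⁻¹ − a)b̂ and w₂⁻¹ = 6(b + b³)(1 − b⁴) + 9b⁶ − 8b², both have infinite order, and w₁ⁿ = w₂ᵐ for integers n, m implies n = m = 0; consequently ⟨w₁, w₂⟩ is a free abelian subgroup of rank 2 (isomorphic to ℤ × ℤ) of U(ℤH_{3,8}). -/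
/-- Relations of the group `H_{3,8} = ⟨a, b ∣ a³ = b⁸ = 1, b⁻¹ab = a⁻¹⟩`. -/
def h38Rels : Set (FreeGroup (Fin 2)) :=
  {FreeGroup.of 0 ^ 3, FreeGroup.of 1 ^ 8,
    (FreeGroup.of 1)⁻¹ * FreeGroup.of 0 * FreeGroup.of 1 * FreeGroup.of 0}

/-- The group `H_{3,8} = ⟨a, b ∣ a³ = b⁸ = 1, b⁻¹ab = a⁻¹⟩`. -/
abbrev H38 := PresentedGroup h38Rels

/-- The generator `a` of `H_{3,8}`. -/
def h38a : H38 := PresentedGroup.of 0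

/-- The generator `b` of `H_{3,8}`. -/
def h38b : H38 := PresentedGroup.of 1

/-- `b̂ = ∑_{i=1}^{8} bⁱ ∈ ℤH_{3,8}`, the sum of the elements of `⟨b⟩`. -/
noncomputable def h38bhat : MonoidAlgebra ℤ H38 :=
  ∑ i ∈ Finset.Icc 1 8, MonoidAlgebra.of ℤ H38 (h38b ^ i)

/-- `w₁ = 1 + (a⁻¹ − a)b̂ ∈ ℤH_{3,8}`. -/
noncomputable def h38w₁ : MonoidAlgebra ℤ H38 :=
  1 + (MonoidAlgebra.of ℤ H38 h38a⁻¹ - MonoidAlgebra.of ℤ H38 h38a) * h38bhat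

/-- `w₂ = 6(b + b³)(1 − b⁴) + 9b² − 8b⁶ ∈ ℤH_{3,8}`. -/
noncomputable def h38w₂ : MonoidAlgebra ℤ H38 :=
  6 * (MonoidAlgebra.of ℤ H38 h38b + MonoidAlgebra.of ℤ H38 (h38b ^ 3))
      * (1 - MonoidAlgebra.of ℤ H38 (h38b ^ 4))
    + 9 * MonoidAlgebra.of ℤ H38 (h38b ^ 2) - 8 * MonoidAlgebra.of ℤ H38 (h38b ^ 6)

section helpers

open Polynomial in
theorem h38_aux_poly :
    (6 * (X + X ^ 3) * (1 - X ^ 4) + 9 * X ^ 2 - 8 * X ^ 6) *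
      (6 * (X + X ^ 3) * (1 - X ^ 4) + 9 * X ^ 6 - 8 * X ^ 2 : ℤ[X]) =
    1 + ((1) * X ^ 0 + (-36) * X ^ 2 + (-6) * X ^ 3 + (-6) * X ^ 5 + (36) * X ^ 6) * (X ^ 8 - 1) := by
  ring

theorem h38_aux_inv {R : Type*} [Ring R] (B : R) (h : B ^ 8 = 1) :
    (6 * (B + B ^ 3) * (1 - B ^ 4) + 9 * B ^ 2 - 8 * B ^ 6) *
      (6 * (B + B ^ 3) * (1 - B ^ 4) + 9 * B ^ 6 - 8 * B ^ 2) = 1 := by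
  have := congrArg (Polynomial.aeval B) h38_aux_poly
  simpa only [map_mul, map_add, map_sub, map_neg, map_pow, map_one, map_ofNat, Polynomial.aeval_X,
    h, sub_self, mul_zero, add_zero] using this

theorem h38_aux_inv' {R : Type*} [Ring R] (B : R) (h : B ^ 8 = 1) :
    (6 * (B + B ^ 3) * (1 - B ^ 4) + 9 * B ^ 6 - 8 * B ^ 2) *
    (6 * (B + B ^ 3) * (1 - B ^ 4) + 9 * B ^ 2 - 8 * B ^ 6) = 1 := by
  have := congrArg (Polynomial.aeval B) ((mul_comm _ _).trans h38_aux_poly)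
  simpa only [map_mul, map_add, map_sub, map_neg, map_pow, map_one, map_ofNat, Polynomial.aeval_X,
    h, sub_self, mul_zero, add_zero] using this

/-- Skew elements: `B C = - C B` makes `C * Bhat` square to zero. -/
theorem h38_aux_sq {R : Type*} [Ring R] (B C S : R) (hC : B * C = -(C * B))
    (hS : S = B + B ^ 2 + B ^ 3 + B ^ 4 + B ^ 5 + B ^ 6 + B ^ 7 + B ^ 8) (hBS : B * S = S) :
    (C * S) * (C * S) = 0 := by
  have h2 : ∀ X, B * (C * X) = -(C * (B * X)) := fun X => by
    rw [← mul_assoc, hC, neg_mul, mul_assoc]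
  have h3 : S * (C * S) = 0 := by
    nth_rewrite 1 [hS]
    simp only [add_mul, pow_succ, pow_zero, one_mul, mul_assoc, h2, hBS, mul_neg, neg_neg]
    abel
  rw [mul_assoc, h3, mul_zero]

theorem h38_aux_comm {R : Type*} [Ring R] (B C S : R) (hC : B * C = -(C * B))
    (hBS : B * S = S) (hSB : S * B = S) :
    (1 + C * S) * (6 * (B + B ^ 3) * (1 - B ^ 4) + 9 * B ^ 2 - 8 * B ^ 6) =
    (6 * (B + B ^ 3) * (1 - B ^ 4) + 9 * B ^ 2 - 8 * B ^ 6) * (1 + C * S) := by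
  have h2 : ∀ X, B * (C * X) = -(C * (B * X)) := fun X => by
    rw [← mul_assoc, hC, neg_mul, mul_assoc]
  set W := 6 * (B + B ^ 3) * (1 - B ^ 4) + 9 * B ^ 2 - 8 * B ^ 6 with hW
  have e1 : W * (C * S) = C * S := by
    have hB1 : B * (C * S) = -(C * S) := by rw [h2, hBS]
    have hB2 : B ^ 2 * (C * S) = C * S := by rw [pow_two, mul_assoc, hB1, mul_neg, hB1, neg_neg]
    have hB4 : B ^ 4 * (C * S) = C * S := by
      rw [show B ^ 4 = B ^ 2 * B ^ 2 by rw [← pow_add], mul_assoc, hB2, hB2]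
    have hB6 : B ^ 6 * (C * S) = C * S := by
      rw [show B ^ 6 = B ^ 4 * B ^ 2 by rw [← pow_add], mul_assoc, hB2, hB4]
    rw [hW, sub_mul, add_mul, mul_assoc _ (1 - B ^ 4), sub_mul 1, one_mul, hB4, sub_self, mul_zero,
      mul_assoc, hB2, mul_assoc, hB6, zero_add, ← sub_mul]
    norm_num
  have e2 : S * W = S := by
    have hn : ∀ n, S * B ^ n = S := fun n => by
      induction n with
      | zero => simp
      | succ k ih => rw [pow_succ, ← mul_assoc, ih, hSB]
    have hc : ∀ (k : ℕ) (n : ℕ), S * ((k : R) * B ^ n) = k * S := fun k n => by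
      rw [← mul_assoc, ← Nat.cast_comm, mul_assoc, hn]
    have h6 : (6 : R) = ((6 : ℕ) : R) := by norm_num
    have h9 : (9 : R) = ((9 : ℕ) : R) := by norm_num
    have h8 : (8 : R) = ((8 : ℕ) : R) := by norm_num
    have hW' : W = 6 * B ^ 1 + 6 * B ^ 3 - 6 * B ^ 5 - 6 * B ^ 7 + 9 * B ^ 2 - 8 * B ^ 6 := by
      rw [hW]; noncomm_ring
    rw [hW', h6, h9, h8]
    simp only [mul_add, mul_sub, hc]
    push_cast
    noncomm_ring
  rw [add_mul, mul_add, e1, mul_assoc, e2, one_mul, mul_one]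

theorem h38_a3 : h38a ^ 3 = 1 :=
  PresentedGroup.one_of_mem (rels := h38Rels) (x := FreeGroup.of 0 ^ 3) (by simp [h38Rels])
theorem h38_b8 : h38b ^ 8 = 1 :=
  PresentedGroup.one_of_mem (rels := h38Rels) (x := FreeGroup.of 1 ^ 8) (by simp [h38Rels])
theorem h38_ab : h38b⁻¹ * h38a * h38b * h38a = 1 :=
  PresentedGroup.one_of_mem (rels := h38Rels)
    (x := (FreeGroup.of 1)⁻¹ * FreeGroup.of 0 * FreeGroup.of 1 * FreeGroup.of 0)
    (by simp [h38Rels])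

noncomputable abbrev h38C : MonoidAlgebra ℤ H38 :=
  MonoidAlgebra.of ℤ H38 h38a⁻¹ - MonoidAlgebra.of ℤ H38 h38a

noncomputable abbrev h38B : MonoidAlgebra ℤ H38 := MonoidAlgebra.of ℤ H38 h38b

theorem h38_B8 : h38B ^ 8 = 1 := by rw [← map_pow, h38_b8, map_one]

theorem h38_BC : h38B * h38C = -(h38C * h38B) := by
  have h1 : h38b * h38a⁻¹ = h38a * h38b := by
    have := h38_ab
    rw [mul_eq_one_iff_eq_inv, mul_assoc, inv_mul_eq_iff_eq_mul] at this
    exact this.symm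
  have h2 : h38b * h38a = h38a⁻¹ * h38b := by
    rw [eq_inv_mul_iff_mul_eq, ← mul_assoc, ← h1, mul_assoc, inv_mul_cancel, mul_one]
  simp only [h38B, h38C, mul_sub, sub_mul, ← map_mul, h1, h2]
  abel

theorem h38_S : h38bhat = h38B + h38B ^ 2 + h38B ^ 3 + h38B ^ 4 + h38B ^ 5 + h38B ^ 6 + h38B ^ 7
    + h38B ^ 8 := by
  simp only [h38bhat, map_pow]
  rw [show Finset.Icc 1 8 = ({1,2,3,4,5,6,7,8} : Finset ℕ) by decide]
  simp
  abel

theorem h38_BS : h38B * h38bhat = h38bhat := by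
  have h := h38_B8
  rw [h38_S]
  generalize h38B = B at h
  simp only [mul_add, ← pow_succ', ← pow_two, Nat.reduceAdd]
  rw [pow_succ' B 8, h, mul_one]
  abel

theorem h38_SB : h38bhat * h38B = h38bhat := by
  have h := h38_B8
  rw [h38_S]
  generalize h38B = B at h
  simp only [add_mul, ← pow_succ, ← pow_two, Nat.reduceAdd]
  rw [pow_succ B 8, h, one_mul]
  abel

theorem h38_w1 : h38w₁ = 1 + h38C * h38bhat := rfl
theorem h38_w2 : h38w₂ = 6 * (h38B + h38B ^ 3) * (1 - h38B ^ 4) + 9 * h38B ^ 2 - 8 * h38B ^ 6 := by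
  simp only [h38w₂, map_pow]

theorem h38_sq : (h38C * h38bhat) * (h38C * h38bhat) = 0 :=
  h38_aux_sq _ _ _ h38_BC h38_S h38_BS

/-- Ring homomorphism out of the group ring. -/
theorem h38_lift {A : Type*} [Ring A] (x y : Aˣ) (h3 : x ^ 3 = 1) (h8 : y ^ 8 = 1)
    (h : y⁻¹ * x * y * x = 1) : ∃ F : MonoidAlgebra ℤ H38 →+* A,
    F (MonoidAlgebra.of ℤ H38 h38a) = x ∧ F (MonoidAlgebra.of ℤ H38 h38a⁻¹) = ((x⁻¹ : Aˣ) : A)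
    ∧ F h38B = y := by
  let g : H38 →* Aˣ := PresentedGroup.toGroup (f := ![x, y]) (by
    intro r hr
    simp only [h38Rels, Set.mem_insert_iff, Set.mem_singleton_iff] at hr
    rcases hr with rfl | rfl | rfl <;> simp [h3, h8, h])
  have ga : g h38a = x := by simp [g, h38a]
  have gb : g h38b = y := by simp [g, h38b]
  refine ⟨(MonoidAlgebra.lift ℤ A H38 ((Units.coeHom A).comp g)).toRingHom, ?_, ?_, ?_⟩
  · simp [ga]
  · simp [ga]
  · simp [gb]

theorem h38_F1 : ∃ F : MonoidAlgebra ℤ H38 →+* Matrix (Fin 2) (Fin 2) ℤ,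
    F (h38C * h38bhat) = !![4, 4; -4, -4] := by
  let x : (Matrix (Fin 2) (Fin 2) ℤ)ˣ :=
    ⟨!![0, -1; 1, -1], !![-1, 1; -1, 0], by decide, by decide⟩
  let y : (Matrix (Fin 2) (Fin 2) ℤ)ˣ :=
    ⟨!![0, 1; 1, 0], !![0, 1; 1, 0], by decide, by decide⟩
  obtain ⟨F, h1, h2, h3⟩ := h38_lift x y (by decide) (by decide) (by decide)
  refine ⟨F, ?_⟩
  rw [h38_S]
  simp only [map_mul, map_sub, map_add, map_pow, h1, h2, h3, x, y]
  decide

theorem h38_F2 : ∃ F : MonoidAlgebra ℤ H38 →+* ℂ, F h38w₁ = 1 ∧ 1 < ‖F h38w₂‖ := by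
  have hs : ((√2 : ℝ) : ℂ) ^ 2 = 2 := by
    rw [← Complex.ofReal_pow, Real.sq_sqrt (by norm_num)]; norm_num
  set z : ℂ := (√2 : ℝ) / 2 * (1 + Complex.I) with hz
  have hz2 : z ^ 2 = Complex.I := by
    rw [hz]; linear_combination (1 / 4 * (1 + Complex.I) ^ 2) * hs + 1 / 2 * Complex.I_sq
  have hz4 : z ^ 4 = -1 := by
    rw [show z ^ 4 = (z ^ 2) ^ 2 by ring, hz2, Complex.I_sq]
  have hz8 : z ^ 8 = 1 := by
    rw [show z ^ 8 = (z ^ 4) ^ 2 by ring, hz4]; norm_num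
  let y : ℂˣ := Units.ofPowEqOne z 8 hz8 (by norm_num)
  obtain ⟨F, h1, h2, h3⟩ := h38_lift (1 : ℂˣ) y (by simp) (Units.pow_ofPowEqOne _ _) (by simp)
  have h3' : F h38B = z := h3
  refine ⟨F, ?_, ?_⟩
  · rw [h38_w1]
    simp only [map_add, map_mul, map_sub, map_one, h1, h2]
    simp
  · have : F h38w₂ = ((17 + 12 * √2 : ℝ) : ℂ) * Complex.I := by
      rw [h38_w2]
      simp only [map_add, map_mul, map_sub, map_one, map_pow, h3', map_ofNat]
      rw [hz4, show z ^ 6 = z ^ 4 * z ^ 2 by ring, show z ^ 3 = z ^ 2 * z by ring, hz4, hz2, hz]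
      push_cast
      linear_combination 6 * (√2 : ℝ) * Complex.I_sq
    rw [this, norm_mul, Complex.norm_I, mul_one, Complex.norm_real, Real.norm_eq_abs]
    have := Real.sqrt_nonneg 2
    rw [abs_of_nonneg (by positivity)]
    linarith

theorem h38_pow (n : ℕ) : h38w₁ ^ n = 1 + n * (h38C * h38bhat) := by
  induction n with
  | zero => simp
  | succ k ih =>
    rw [pow_succ, ih, h38_w1, mul_add, mul_one, add_mul, one_mul, mul_assoc, h38_sq]
    push_cast
    noncomm_ring

theorem h38_npow (n : ℕ) (h : h38w₁ ^ n = 1) : n = 0 := by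
  obtain ⟨F, hF⟩ := h38_F1
  rw [h38_pow] at h
  have h1 := congrArg F (add_eq_left.mp h)
  rw [map_mul, map_natCast, hF, map_zero] at h1
  have h2 := congrFun (congrFun h1 0) 0
  rw [← nsmul_eq_mul] at h2
  simpa using h2

theorem h38_indep (u v : (MonoidAlgebra ℤ H38)ˣ) (hu : (u : MonoidAlgebra ℤ H38) = h38w₁)
    (hv : (v : MonoidAlgebra ℤ H38) = h38w₂) (n m : ℤ) (h : u ^ n * v ^ m = 1) :
    n = 0 ∧ m = 0 := by
  have hm : m = 0 := by
    obtain ⟨F, h1, h2⟩ := h38_F2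
    have h3 := congrArg (Units.map (F : MonoidAlgebra ℤ H38 →* ℂ)) h
    have hu1 : Units.map (F : MonoidAlgebra ℤ H38 →* ℂ) u = 1 := by
      ext; simp [hu, h1]
    rw [map_mul, map_zpow, map_zpow, hu1, one_zpow, one_mul, map_one] at h3
    have h4 := congrArg (fun t : ℂˣ => ‖(t : ℂ)‖) h3
    simp only [Units.val_zpow_eq_zpow_val, norm_zpow, Units.coe_map, Units.val_one, norm_one,
      MonoidHom.coe_coe, hv] at h4
    exact (zpow_eq_one_iff_right₀ (by positivity) h2.ne').mp h4
  subst hm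
  refine ⟨?_, rfl⟩
  rw [zpow_zero, mul_one] at h
  have h5 : u ^ n.natAbs = 1 := by
    rcases Int.natAbs_eq n with h' | h'
    · rw [h', zpow_natCast] at h; exact h
    · rw [h', zpow_neg, zpow_natCast, inv_eq_one] at h; exact h
  have h6 := congrArg Units.val h5
  rw [Units.val_pow_eq_pow_val, hu, Units.val_one] at h6
  exact Int.natAbs_eq_zero.mp (h38_npow _ h6)

theorem h38_iso {G : Type*} [Group G] (u v : G) (hc : Commute u v)
    (h : ∀ n m : ℤ, u ^ n * v ^ m = 1 → n = 0 ∧ m = 0) :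
    Nonempty ((Subgroup.closure {u, v} : Subgroup G) ≃* Multiplicative (ℤ × ℤ)) := by
  let f : Multiplicative (ℤ × ℤ) →* G :=
    { toFun := fun p => u ^ p.toAdd.1 * v ^ p.toAdd.2
      map_one' := by simp
      map_mul' := fun p q => by
        simp only [toAdd_mul, Prod.fst_add, Prod.snd_add, zpow_add]
        have := (hc.zpow_zpow q.toAdd.1 p.toAdd.2).eq
        rw [mul_assoc, ← mul_assoc (u ^ q.toAdd.1), this]
        simp only [mul_assoc] }
  have hf : Function.Injective f := by
    rw [injective_iff_map_eq_one]
    intro p hp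
    obtain ⟨h1, h2⟩ := h _ _ hp
    exact Multiplicative.toAdd.injective (Prod.ext h1 h2)
  have hr : f.range = Subgroup.closure {u, v} := by
    apply le_antisymm
    · rintro _ ⟨p, rfl⟩
      exact mul_mem (zpow_mem (Subgroup.subset_closure (by simp)) _)
        (zpow_mem (Subgroup.subset_closure (by simp)) _)
    · rw [Subgroup.closure_le]
      rintro x (rfl | rfl)
      · exact ⟨Multiplicative.ofAdd (1, 0), by simp [f]⟩
      · exact ⟨Multiplicative.ofAdd (0, 1), by simp [f]⟩
  exact ⟨((MonoidHom.ofInjective hf).trans (MulEquiv.subgroupCongr hr)).symm⟩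

end helpers

/-- In `ℤH_{3,8}`, the elements `w₁ = 1 + (a⁻¹ − a)b̂` and
`w₂ = 6(b + b³)(1 − b⁴) + 9b² − 8b⁶` are commuting units with the indicated inverses,
both of infinite order, satisfying no relation `w₁ⁿ = w₂ᵐ` except `n = m = 0`; hence
`⟨w₁, w₂⟩` is a free abelian subgroup of rank 2 (isomorphic to `ℤ × ℤ`) of `U(ℤH_{3,8})`. -/
theorem h38_units_generate_Z2 :
    h38w₁ * h38w₂ = h38w₂ * h38w₁
    ∧ (∃ u : (MonoidAlgebra ℤ H38)ˣ, (u : MonoidAlgebra ℤ H38) = h38w₁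
        ∧ ((u⁻¹ : (MonoidAlgebra ℤ H38)ˣ) : MonoidAlgebra ℤ H38)
            = 1 - (MonoidAlgebra.of ℤ H38 h38a⁻¹ - MonoidAlgebra.of ℤ H38 h38a) * h38bhat)
    ∧ (∃ v : (MonoidAlgebra ℤ H38)ˣ, (v : MonoidAlgebra ℤ H38) = h38w₂
        ∧ ((v⁻¹ : (MonoidAlgebra ℤ H38)ˣ) : MonoidAlgebra ℤ H38)
            = 6 * (MonoidAlgebra.of ℤ H38 h38b + MonoidAlgebra.of ℤ H38 (h38b ^ 3))
                * (1 - MonoidAlgebra.of ℤ H38 (h38b ^ 4))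
              + 9 * MonoidAlgebra.of ℤ H38 (h38b ^ 6)
              - 8 * MonoidAlgebra.of ℤ H38 (h38b ^ 2))
    ∧ (∀ u v : (MonoidAlgebra ℤ H38)ˣ,
        (u : MonoidAlgebra ℤ H38) = h38w₁ → (v : MonoidAlgebra ℤ H38) = h38w₂ →
        ¬ IsOfFinOrder u ∧ ¬ IsOfFinOrder v ∧ Commute u v
        ∧ (∀ n m : ℤ, u ^ n = v ^ m → n = 0 ∧ m = 0)
        ∧ Nonempty ((Subgroup.closure {u, v} : Subgroup (MonoidAlgebra ℤ H38)ˣ)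
            ≃* Multiplicative (ℤ × ℤ))) := by
  have hcomm : h38w₁ * h38w₂ = h38w₂ * h38w₁ := by
    rw [h38_w2, h38_w1]
    exact h38_aux_comm _ _ _ h38_BC h38_BS h38_SB
  refine ⟨hcomm, ?_, ?_, ?_⟩
  · refine ⟨⟨h38w₁, 1 - h38C * h38bhat, ?_, ?_⟩, rfl, rfl⟩
    · rw [h38_w1, mul_sub, mul_one, add_mul, one_mul, h38_sq]; abel
    · rw [h38_w1, mul_add, mul_one, sub_mul 1 (h38C * h38bhat), one_mul, h38_sq]; abel
  · refine ⟨⟨h38w₂, 6 * (h38B + h38B ^ 3) * (1 - h38B ^ 4) + 9 * h38B ^ 6 - 8 * h38B ^ 2,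
      ?_, ?_⟩, rfl, ?_⟩
    · rw [h38_w2]; exact h38_aux_inv _ h38_B8
    · rw [h38_w2]; exact h38_aux_inv' _ h38_B8
    · simp only [map_pow, Units.inv_mk]
  · intro u v hu hv
    have key := h38_indep u v hu hv
    have hc : Commute u v := Units.ext (by simpa [hu, hv] using hcomm)
    refine ⟨?_, ?_, hc, ?_, h38_iso u v hc key⟩
    · rw [isOfFinOrder_iff_pow_eq_one]
      rintro ⟨n, hn, h⟩
      have := (key n 0 (by simpa using h)).1
      omega
    · rw [isOfFinOrder_iff_pow_eq_one]
      rintro ⟨n, hn, h⟩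
      have := (key 0 n (by simpa using h)).2
      omega
    · intro n m h
      have := key n (-m) (by rw [h, zpow_neg, mul_inv_cancel])
      omega
end

section
/- Let K be a field of characteristic p > 0, G a group, w ∈ G an element of order p such that the cyclic subgroup ⟨w⟩ is normal in G, and t ∈ G an element of infinite order. Then for every integer i, the element 1 + tⁱŵ is a unit of KG of order p, these units are pairwise distinct for distinct i, and the subgroup of U(KG) they generate is an infinite abelian group of exponent p. -/
/-- `hatSum w` is `ŵ`, the sum in the group algebra `K[G]` of all elements of the
cyclic subgroup generated by an element `w` of finite order. -/
noncomputable def hatSum (K : Type*) {G : Type*} [Field K] [Group G] (w : G) :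
    MonoidAlgebra K G :=
  ∑ i ∈ Finset.range (orderOf w), MonoidAlgebra.of K G (w ^ i)

lemma hatSum_coeff_of_mem {K G : Type*} [Field K] [Group G] {w : G} (hw : IsOfFinOrder w)
    {g : G} (hg : g ∈ Subgroup.zpowers w) : (hatSum K w).coeff g = 1 := by
  classical
  rw [hw.mem_zpowers_iff_mem_range_orderOf, Finset.mem_image] at hg
  obtain ⟨k, hk, rfl⟩ := hg
  rw [hatSum, MonoidAlgebra.coeff_sum, Finsupp.finsetSum_apply, Finset.sum_eq_single k]
  · simp [MonoidAlgebra.of_apply]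
  · intro b hb hbk
    rw [MonoidAlgebra.of_apply, MonoidAlgebra.coeff_single, Finsupp.single_apply, if_neg]
    intro h
    exact hbk (pow_injOn_Iio_orderOf (by simpa using hb) (by simpa using hk) h)
  · intro h
    exact absurd hk h

lemma hatSum_coeff_of_not_mem {K G : Type*} [Field K] [Group G] {w : G}
    {g : G} (hg : g ∉ Subgroup.zpowers w) : (hatSum K w).coeff g = 0 := by
  classical
  rw [hatSum, MonoidAlgebra.coeff_sum, Finsupp.finsetSum_apply]
  refine Finset.sum_eq_zero fun b _ => ?_
  rw [MonoidAlgebra.of_apply, MonoidAlgebra.coeff_single, Finsupp.single_apply, if_neg]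
  rintro rfl
  exact hg (Subgroup.npow_mem_zpowers w b)

lemma hatSum_coeff_congr {K G : Type*} [Field K] [Group G] {w : G} (hw : IsOfFinOrder w)
    {g h : G} (hgh : g ∈ Subgroup.zpowers w ↔ h ∈ Subgroup.zpowers w) :
    (hatSum K w).coeff g = (hatSum K w).coeff h := by
  by_cases hg : g ∈ Subgroup.zpowers w
  · rw [hatSum_coeff_of_mem hw hg, hatSum_coeff_of_mem hw (hgh.1 hg)]
  · rw [hatSum_coeff_of_not_mem hg, hatSum_coeff_of_not_mem (fun h => hg (hgh.2 h))]

lemma hatSum_comm {K G : Type*} [Field K] [Group G] {w : G} (hw : IsOfFinOrder w)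
    (hnorm : (Subgroup.zpowers w).Normal) (g : G) :
    hatSum K w * MonoidAlgebra.of K G g = MonoidAlgebra.of K G g * hatSum K w := by
  ext x
  simp only [MonoidAlgebra.of_apply, MonoidAlgebra.coeff_mul_single_apply,
    MonoidAlgebra.coeff_single_mul_apply, mul_one, one_mul]
  exact hatSum_coeff_congr hw hnorm.mem_comm_iff

lemma nsmul_char_zero {K G : Type*} [Field K] [Group G] (p : ℕ) [CharP K p]
    (x : MonoidAlgebra K G) : p • x = 0 := by
  rw [← Nat.cast_smul_eq_nsmul K, CharP.cast_eq_zero, zero_smul]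

lemma hatSum_sq {K G : Type*} [Field K] [Group G] (p : ℕ) [CharP K p] {w : G}
    (hf : IsOfFinOrder w) (hw : orderOf w = p) : hatSum K w * hatSum K w = 0 := by
  have key : ∀ i : ℕ, MonoidAlgebra.of K G (w ^ i) * hatSum K w = hatSum K w := by
    intro i
    ext x
    simp only [MonoidAlgebra.of_apply, MonoidAlgebra.coeff_single_mul_apply, one_mul]
    exact hatSum_coeff_congr hf
      (Subgroup.mul_mem_cancel_left _ (inv_mem (Subgroup.npow_mem_zpowers w i)))
  conv_lhs => arg 1; rw [hatSum]
  rw [Finset.sum_mul, Finset.sum_congr rfl (fun i _ => key i), Finset.sum_const,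
    Finset.card_range, hw, nsmul_char_zero]

lemma one_add_pow_of_sq_zero {R : Type*} [Ring R] {a : R} (ha : a * a = 0) (n : ℕ) :
    (1 + a) ^ n = 1 + n • a := by
  induction n with
  | zero => simp
  | succ n ih =>
    rw [pow_succ, ih, mul_add, add_mul 1 (n • a) a, smul_mul_assoc n a a, ha, succ_nsmul]
    simp only [mul_one, one_mul, smul_zero, add_zero]
    abel

/-- Let `K` be a field of characteristic `p > 0`, `w ∈ G` of order `p` with `⟨w⟩`
normal in `G`, and `t ∈ G` of infinite order.  Then each `1 + tⁱŵ` (`i ∈ ℤ`) is a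
unit of `KG` of order `p`, these units are pairwise distinct, and the subgroup of
`U(KG)` they generate is an infinite abelian group of exponent `p`. -/
theorem units_from_normal_p_subgroup {K G : Type*} [Field K] [Group G]
    (p : ℕ) [Fact p.Prime] [CharP K p] (w t : G)
    (hw : orderOf w = p) (hnorm : (Subgroup.zpowers w).Normal)
    (ht : ¬ IsOfFinOrder t) :
    (∀ i : ℤ, ∃ u : (MonoidAlgebra K G)ˣ,
        (u : MonoidAlgebra K G) = 1 + MonoidAlgebra.of K G (t ^ i) * hatSum K w
        ∧ orderOf u = p)
    ∧ Function.Injective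
        (fun i : ℤ => 1 + MonoidAlgebra.of K G (t ^ i) * hatSum K w)
    ∧ (Infinite (Subgroup.closure {u : (MonoidAlgebra K G)ˣ |
          ∃ i : ℤ, (u : MonoidAlgebra K G)
            = 1 + MonoidAlgebra.of K G (t ^ i) * hatSum K w})
        ∧ (∀ x ∈ Subgroup.closure {u : (MonoidAlgebra K G)ˣ |
            ∃ i : ℤ, (u : MonoidAlgebra K G)
              = 1 + MonoidAlgebra.of K G (t ^ i) * hatSum K w},
          ∀ y ∈ Subgroup.closure {u : (MonoidAlgebra K G)ˣ |
            ∃ i : ℤ, (u : MonoidAlgebra K G)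
              = 1 + MonoidAlgebra.of K G (t ^ i) * hatSum K w}, Commute x y)
        ∧ ∀ x ∈ Subgroup.closure {u : (MonoidAlgebra K G)ˣ |
            ∃ i : ℤ, (u : MonoidAlgebra K G)
              = 1 + MonoidAlgebra.of K G (t ^ i) * hatSum K w}, x ^ p = 1) := by
  classical
  have hp : p.Prime := Fact.out
  have hf : IsOfFinOrder w := by
    rw [← orderOf_pos_iff, hw]; exact hp.pos
  have hmul : ∀ i j : ℤ, (MonoidAlgebra.of K G (t ^ i) * hatSum K w) *
      (MonoidAlgebra.of K G (t ^ j) * hatSum K w) = 0 := by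
    intro i j
    rw [← hatSum_comm hf hnorm (t ^ j), mul_assoc, ← mul_assoc (hatSum K w) (hatSum K w),
      hatSum_sq p hf hw, zero_mul, mul_zero]
  have hc : ∀ i : ℤ, (MonoidAlgebra.of K G (t ^ i) * hatSum K w).coeff (t ^ i) = 1 := by
    intro i
    simp only [MonoidAlgebra.of_apply, MonoidAlgebra.coeff_single_mul_apply, one_mul]
    exact hatSum_coeff_of_mem hf (by simp)
  have hne : ∀ i : ℤ, MonoidAlgebra.of K G (t ^ i) * hatSum K w ≠ 0 := by
    intro i h
    have := hc i
    rw [h] at this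
    simp at this
  have hinj : Function.Injective
      (fun i : ℤ => 1 + MonoidAlgebra.of K G (t ^ i) * hatSum K w) := by
    intro i j hij
    have hij' := add_left_cancel hij
    have h1 := hc i
    rw [hij'] at h1
    simp only [MonoidAlgebra.of_apply, MonoidAlgebra.coeff_single_mul_apply, one_mul] at h1
    have hmem : (t ^ j)⁻¹ * t ^ i ∈ Subgroup.zpowers w := by
      by_contra hcon
      rw [hatSum_coeff_of_not_mem hcon] at h1
      exact zero_ne_one h1
    have hfin : IsOfFinOrder (t ^ (i - j)) := by
      have h2 : (t ^ j)⁻¹ * t ^ i = t ^ (i - j) := by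
        rw [← zpow_neg, ← zpow_add]; congr 1; ring
      rw [← h2]
      exact hf.of_mem_zpowers hmem
    by_contra hne'
    obtain ⟨n, hn, hn1⟩ := isOfFinOrder_iff_pow_eq_one.1 hfin
    apply ht
    rw [isOfFinOrder_iff_zpow_eq_one]
    refine ⟨(i - j) * n, mul_ne_zero (sub_ne_zero.2 hne') (by omega), ?_⟩
    rw [zpow_mul, zpow_natCast, hn1]
  have hpow : ∀ (u : (MonoidAlgebra K G)ˣ) (i : ℤ), (u : MonoidAlgebra K G)
      = 1 + MonoidAlgebra.of K G (t ^ i) * hatSum K w → u ^ p = 1 := by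
    intro u i hu
    ext1
    rw [Units.val_pow_eq_pow_val, hu, one_add_pow_of_sq_zero (hmul i i), nsmul_char_zero,
      add_zero, Units.val_one]
  have hex : ∀ i : ℤ, ∃ u : (MonoidAlgebra K G)ˣ,
      (u : MonoidAlgebra K G) = 1 + MonoidAlgebra.of K G (t ^ i) * hatSum K w := by
    intro i
    refine ⟨⟨1 + MonoidAlgebra.of K G (t ^ i) * hatSum K w,
      1 - MonoidAlgebra.of K G (t ^ i) * hatSum K w, ?_, ?_⟩, rfl⟩
    · rw [mul_sub, add_mul, add_mul, hmul]; simp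
    · rw [mul_add, sub_mul, sub_mul, hmul]; simp
  have hcomm : ∀ x ∈ Subgroup.closure {u : (MonoidAlgebra K G)ˣ |
        ∃ i : ℤ, (u : MonoidAlgebra K G) = 1 + MonoidAlgebra.of K G (t ^ i) * hatSum K w},
      ∀ y ∈ Subgroup.closure {u : (MonoidAlgebra K G)ˣ |
        ∃ i : ℤ, (u : MonoidAlgebra K G) = 1 + MonoidAlgebra.of K G (t ^ i) * hatSum K w},
      Commute x y := by
    intro x hx y hy
    induction hx, hy using Subgroup.closure_induction₂ with
    | mem x y hx hy =>
      obtain ⟨i, hi⟩ := hx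
      obtain ⟨j, hj⟩ := hy
      ext1
      rw [Units.val_mul, Units.val_mul, hi, hj, mul_add, add_mul, add_mul, mul_add, add_mul,
        add_mul, hmul, hmul]
      simp only [mul_one, one_mul, add_zero]
      abel
    | one_left x hx => exact Commute.one_left x
    | one_right x hx => exact Commute.one_right x
    | mul_left x y z _ _ _ h1 h2 => exact h1.mul_left h2
    | mul_right x y z _ _ _ h1 h2 => exact h1.mul_right h2
    | inv_left x y _ _ h => exact h.inv_left
    | inv_right x y _ _ h => exact h.inv_right
  refine ⟨?_, hinj, ?_, hcomm, ?_⟩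
  · intro i
    obtain ⟨u, hu⟩ := hex i
    refine ⟨u, hu, orderOf_eq_prime (hpow u i hu) ?_⟩
    rintro rfl
    rw [Units.val_one] at hu
    exact hne i (left_eq_add.1 hu)
  · choose f hfu using hex
    refine Infinite.of_injective (fun i : ℤ => (⟨f i, Subgroup.subset_closure ⟨i, hfu i⟩⟩ :
      Subgroup.closure {u : (MonoidAlgebra K G)ˣ | ∃ i : ℤ, (u : MonoidAlgebra K G)
            = 1 + MonoidAlgebra.of K G (t ^ i) * hatSum K w})) ?_
    intro i j hij
    apply hinj
    have h : f i = f j := congrArg Subtype.val hij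
    change 1 + _ = 1 + _
    rw [← hfu i, ← hfu j, h]
  · intro x hx
    induction hx using Subgroup.closure_induction with
    | mem x hx => obtain ⟨i, hi⟩ := hx; exact hpow x i hi
    | one => exact one_pow p
    | mul x y hx hy h1 h2 => rw [(hcomm x hx y hy).mul_pow, h1, h2, one_mul]
    | inv x _ h => rw [inv_pow, h, inv_one]
end

section
/- Let G be a group, let Δ(G) = {g ∈ G : [G : C_G(g)] < ∞} be its FC-center, and let t(Δ(G)) denote the set of torsion elements of Δ(G) (which is a normal subgroup of Δ(G) with torsion-free abelian quotient, by Neumann's theorem). If the quotient Δ(G)/t(Δ(G)) contains a free abelian subgroup of rank 2, then G contains a subgroup isomorphic to ℤ × ℤ. -/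
/-- If the quotient of the FC-center `Δ(G) = {g : [G : C_G(g)] < ∞}` by its torsion
subgroup contains a free abelian subgroup of rank 2 — equivalently, there are
`x, y ∈ Δ(G)` whose images in the (torsion-free abelian) quotient are independent,
i.e. `x^m y^n` is of finite order only when `m = n = 0` — then `G` contains a
subgroup isomorphic to `ℤ × ℤ`. -/
theorem fc_center_quotient_rank_two {G : Type*} [Group G]
    (x y : G)
    (hx : (Subgroup.centralizer {x}).FiniteIndex)
    (hy : (Subgroup.centralizer {y}).FiniteIndex)
    (hindep : ∀ m n : ℤ, IsOfFinOrder (x ^ m * y ^ n) → m = 0 ∧ n = 0) :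
    ∃ H : Subgroup G, Nonempty (H ≃* Multiplicative (ℤ × ℤ)) := by
  obtain ⟨k, hk0, -, hk⟩ := Subgroup.exists_pow_mem_of_index_ne_zero hx.index_ne_zero y
  have hc : Commute x (y ^ k) := by
    rw [Subgroup.mem_centralizer_singleton_iff] at hk
    first
      | exact hk
      | exact Eq.symm hk
  let f : Multiplicative (ℤ × ℤ) →* G :=
    { toFun := fun p => x ^ p.toAdd.1 * (y ^ k) ^ p.toAdd.2
      map_one' := by simp
      map_mul' := by
        intro p q
        simp only [toAdd_mul, Prod.fst_add, Prod.snd_add, zpow_add]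
        have h := (hc.zpow_zpow q.toAdd.1 p.toAdd.2).eq
        simp only [mul_assoc]
        rw [← mul_assoc (x ^ q.toAdd.1), h, mul_assoc] }
  have hf : Function.Injective f := by
    rw [injective_iff_map_eq_one]
    intro p hp
    have hp' : x ^ p.toAdd.1 * (y ^ k) ^ p.toAdd.2 = 1 := hp
    rw [← zpow_natCast, ← zpow_mul] at hp'
    obtain ⟨h1, h2⟩ := hindep _ _ (hp' ▸ IsOfFinOrder.one)
    have h3 : p.toAdd.2 = 0 := by
      rcases mul_eq_zero.mp h2 with h | h
      · omega
      · exact h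
    exact Multiplicative.toAdd.injective (Prod.ext h1 h3)
  exact ⟨f.range, ⟨(MonoidHom.ofInjective hf).symm⟩⟩
end
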